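/- arXiv:1505.03388 — 8 statements merged into one kernel-verified Lean document; each statement's English description precedes it below -/
import Mathlib

section
/- Let K ⊆ ℝ^d be a closed convex set (d ≥ 2). Let T_K ⊆ S^{d−1} × S^{d−1} be the set of pairs (v,w) such that there exist points x ≠ y with the closed segment [x,y] contained in the boundary ∂K, v = (y−x)/|y−x|, and w ∈ nor(K,z) for every z ∈ [x,y] (i.e. the segment lies in a supporting hyperplane of K with outward unit normal direction w). Then T_K, regarded as a subset of ℝ^d × ℝ^d = ℝ^{2d}, is a countable union of sets each having finite (d−2)-dimensional upper Minkowski content. -/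
open MeasureTheory Metric Filter Set Pointwise
open scoped RealInnerProductSpace ENNReal

/-- The `m`-dimensional upper Minkowski content of a subset of `ℝ^D`. -/
noncomputable def minkContent {D : ℕ} (m : ℝ) (S : Set (EuclideanSpace ℝ (Fin D))) : ℝ≥0∞ :=
  Filter.limsup
    (fun ε : ℝ => ENNReal.ofReal ((2 * ε) ^ (m - (D : ℝ))) * volume (Metric.cthickening ε S))
    (nhdsWithin 0 (Set.Ioi 0))

/-- The set of unit outer normals to `K` at `x`. -/
def nor {d : ℕ} (K : Set (EuclideanSpace ℝ (Fin d))) (x : EuclideanSpace ℝ (Fin d)) :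
    Set (EuclideanSpace ℝ (Fin d)) :=
  {u | ‖u‖ = 1 ∧ ∀ y ∈ K, ⟪u, y⟫ ≤ ⟪u, x⟫}

/-- Concatenation `ℝ^m × ℝ^n → ℝ^(m+n)` (an isometry for the `L²` product structure). -/
noncomputable def appendE {m n : ℕ} (x : EuclideanSpace ℝ (Fin m)) (y : EuclideanSpace ℝ (Fin n)) :
    EuclideanSpace ℝ (Fin (m + n)) :=
  (EuclideanSpace.equiv (Fin (m + n)) ℝ).symm
    (Fin.append (EuclideanSpace.equiv (Fin m) ℝ x) (EuclideanSpace.equiv (Fin n) ℝ y))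

/-- The support function of `K`. -/
noncomputable def suppF {d : ℕ} (K : Set (EuclideanSpace ℝ (Fin d)))
    (n : EuclideanSpace ℝ (Fin d)) : ℝ :=
  sSup ((fun x => ⟪x, n⟫) '' K)

/-- The cap of `K` of direction `n` and width `t`. -/
def cap {d : ℕ} (K : Set (EuclideanSpace ℝ (Fin d))) (n : EuclideanSpace ℝ (Fin d)) (t : ℝ) :
    Set (EuclideanSpace ℝ (Fin d)) :=
  {x ∈ K | suppF K n - t ≤ ⟪x, n⟫}

/-- The width of `K`. -/
noncomputable def bwidth {d : ℕ} (K : Set (EuclideanSpace ℝ (Fin d))) : ℝ :=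
  sInf ((fun n => suppF K n + suppF K (-n)) '' {n : EuclideanSpace ℝ (Fin d) | ‖n‖ = 1})

/-! ### The Lebesgue measure on `ℝ^(m+n)` as a product -/

/-- The first `m` coordinates of a vector of `ℝ^(m+n)`. -/
noncomputable def fstE {m n : ℕ} (q : EuclideanSpace ℝ (Fin (m + n))) :
    EuclideanSpace ℝ (Fin m) :=
  WithLp.toLp 2 fun i => q (Fin.castAdd n i)

/-- The last `n` coordinates of a vector of `ℝ^(m+n)`. -/
noncomputable def sndE {m n : ℕ} (q : EuclideanSpace ℝ (Fin (m + n))) :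
    EuclideanSpace ℝ (Fin n) :=
  WithLp.toLp 2 fun i => q (Fin.natAdd m i)

lemma fstE_appendE {m n : ℕ} (x : EuclideanSpace ℝ (Fin m)) (y : EuclideanSpace ℝ (Fin n)) :
    fstE (appendE x y) = x := by
  ext i
  simp [fstE, appendE]

lemma sndE_appendE {m n : ℕ} (x : EuclideanSpace ℝ (Fin m)) (y : EuclideanSpace ℝ (Fin n)) :
    sndE (appendE x y) = y := by
  ext i
  simp [sndE, appendE]

lemma dist_fstE_le {m n : ℕ} (p q : EuclideanSpace ℝ (Fin (m + n))) :
    dist (fstE p) (fstE q) ≤ dist p q := by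
  rw [EuclideanSpace.dist_eq, EuclideanSpace.dist_eq, Fin.sum_univ_add]
  exact Real.sqrt_le_sqrt (le_add_of_nonneg_right (Finset.sum_nonneg fun i _ => sq_nonneg _))

lemma dist_sndE_le {m n : ℕ} (p q : EuclideanSpace ℝ (Fin (m + n))) :
    dist (sndE p) (sndE q) ≤ dist p q := by
  rw [EuclideanSpace.dist_eq, EuclideanSpace.dist_eq, Fin.sum_univ_add]
  exact Real.sqrt_le_sqrt (le_add_of_nonneg_left (Finset.sum_nonneg fun i _ => sq_nonneg _))

lemma measurePreserving_fstE_sndE (m n : ℕ) :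
    MeasurePreserving (fun q : EuclideanSpace ℝ (Fin (m + n)) => (fstE q, sndE q)) := by
  have h1 := PiLp.volume_preserving_ofLp (Fin (m + n))
  have h2 := (volume_measurePreserving_piCongrLeft (fun _ : Fin (m + n) => ℝ)
    (finSumFinEquiv (m := m) (n := n))).symm
  have h3 := volume_measurePreserving_sumPiEquivProdPi (fun _ : Fin m ⊕ Fin n => ℝ)
  have h4 := (PiLp.volume_preserving_toLp (Fin m)).prod (PiLp.volume_preserving_toLp (Fin n))
  exact h4.comp (h3.comp (h2.comp h1))

lemma volume_fstE_sndE_le {m n : ℕ} (A : Set (EuclideanSpace ℝ (Fin m)))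
    (B : Set (EuclideanSpace ℝ (Fin n))) :
    volume {q : EuclideanSpace ℝ (Fin (m + n)) | fstE q ∈ A ∧ sndE q ∈ B} ≤
      volume A * volume B := by
  calc volume {q : EuclideanSpace ℝ (Fin (m + n)) | fstE q ∈ A ∧ sndE q ∈ B}
      ≤ volume ((fun q : EuclideanSpace ℝ (Fin (m + n)) => (fstE q, sndE q)) ⁻¹'
          (toMeasurable volume A ×ˢ toMeasurable volume B)) :=
        measure_mono fun q hq =>
          ⟨subset_toMeasurable _ _ hq.1, subset_toMeasurable _ _ hq.2⟩
    _ = volume A * volume B := by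
        rw [(measurePreserving_fstE_sndE m n).measure_preimage
          ((measurableSet_toMeasurable _ _).prod
            (measurableSet_toMeasurable _ _)).nullMeasurableSet,
          Measure.volume_eq_prod, Measure.prod_prod, measure_toMeasurable, measure_toMeasurable]

/-! ### Homotheties and Macbeath regions -/

/-- The shell between a convex body and a slightly smaller homothetic copy has small volume. -/
lemma volume_diff_homothety_le {d : ℕ} {S : Set (EuclideanSpace ℝ (Fin d))}
    (hconv : Convex ℝ S) (hS : IsCompact S)
    {p : EuclideanSpace ℝ (Fin d)} (hp : p ∈ S) {r : ℝ} (hr0 : 0 < r) (hr1 : r ≤ 1) :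
    volume (S \ AffineMap.homothety p r '' S) ≤ ENNReal.ofReal (d * (1 - r)) * volume S := by
  have hsub : AffineMap.homothety p r '' S ⊆ S := by
    rintro _ ⟨y, hy, rfl⟩
    rw [AffineMap.homothety_eq_lineMap]
    exact hconv.lineMap_mem hp hy ⟨hr0.le, hr1⟩
  have hm : MeasurableSet (AffineMap.homothety p r '' S) :=
    (hS.image (AffineMap.homothety_continuous p r)).isClosed.measurableSet
  rw [measure_sdiff hsub hm.nullMeasurableSet (measure_ne_top_of_subset hsub hS.measure_ne_top),
    Measure.addHaar_image_homothety, finrank_euclideanSpace_fin, abs_of_nonneg (by positivity)]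
  have hb : 1 - r ^ d ≤ d * (1 - r) := by
    have := one_add_mul_le_pow (a := r - 1) (by linarith) d
    rw [add_sub_cancel] at this
    linarith
  rw [tsub_le_iff_right, ← add_mul,
    ← ENNReal.ofReal_add (mul_nonneg (by positivity) (by linarith)) (by positivity)]
  refine le_mul_of_one_le_left' ?_
  rw [← ENNReal.ofReal_one]
  exact ENNReal.ofReal_le_ofReal (by linarith)

/-- The centred Macbeath region of `P` at `z`. -/
def macbeath {d : ℕ} (P : Set (EuclideanSpace ℝ (Fin d))) (z : EuclideanSpace ℝ (Fin d)) :
    Set (EuclideanSpace ℝ (Fin d)) :=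
  {u | z + u ∈ P ∧ z - u ∈ P}

lemma convex_macbeath {d : ℕ} {P : Set (EuclideanSpace ℝ (Fin d))} (hP : Convex ℝ P)
    (z : EuclideanSpace ℝ (Fin d)) : Convex ℝ (macbeath P z) := by
  intro u hu v hv a b ha hb hab
  constructor
  · convert hP hu.1 hv.1 ha hb hab using 1
    rw [smul_add, smul_add, add_add_add_comm, ← add_smul, hab, one_smul]
  · convert hP hu.2 hv.2 ha hb hab using 1
    rw [smul_sub, smul_sub, sub_add_sub_comm, ← add_smul, hab, one_smul]

lemma isClosed_macbeath {d : ℕ} {P : Set (EuclideanSpace ℝ (Fin d))} (hP : IsClosed P)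
    (z : EuclideanSpace ℝ (Fin d)) : IsClosed (macbeath P z) :=
  (hP.preimage (continuous_const.add continuous_id)).inter
    (hP.preimage (continuous_const.sub continuous_id))

lemma macbeath_subset_vadd {d : ℕ} (P : Set (EuclideanSpace ℝ (Fin d)))
    (z : EuclideanSpace ℝ (Fin d)) : macbeath P z ⊆ (-z) +ᵥ P := by
  intro u hu
  exact ⟨z + u, hu.1, by simp⟩

/-- If the half-size Macbeath regions at `z` and `z'` meet, then the regions are comparable. -/
lemma macbeath_compare {d : ℕ} {P : Set (EuclideanSpace ℝ (Fin d))} (hP : Convex ℝ P)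
    {z z' a a' u : EuclideanSpace ℝ (Fin d)} (ha : a ∈ macbeath P z) (ha' : a' ∈ macbeath P z')
    (h : z + (1 / 2 : ℝ) • a = z' + (1 / 2 : ℝ) • a') (hu : u ∈ macbeath P z') :
    (1 / 3 : ℝ) • u ∈ macbeath P z := by
  have key : ∀ u : EuclideanSpace ℝ (Fin d), z' + u ∈ P → z + (1 / 3 : ℝ) • u ∈ P := by
    intro u hu
    have h1 : (1 / 2 : ℝ) • (z' + a') + (1 / 2 : ℝ) • (z' + u) ∈ P :=
      hP ha'.1 hu (by norm_num) (by norm_num) (by norm_num)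
    have h2 : (2 / 3 : ℝ) • ((1 / 2 : ℝ) • (z' + a') + (1 / 2 : ℝ) • (z' + u)) +
        (1 / 3 : ℝ) • (z - a) ∈ P := hP h1 ha.2 (by norm_num) (by norm_num) (by norm_num)
    convert h2 using 1
    have h3 : z' = z + (1 / 2 : ℝ) • a - (1 / 2 : ℝ) • a' := by rw [h]; abel
    rw [h3]
    module
  refine ⟨key u hu.1, ?_⟩
  have := key (-u) (by simpa [sub_eq_add_neg] using hu.2)
  simpa [sub_eq_add_neg] using this

/-- A vector of norm at most `δ` splits into a part orthogonal to the unit vector `w`, an integer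
multiple of `δ ^ 2 • w`, and a remainder in the direction of `w` of length at most `δ ^ 2`. -/
lemma exists_slab_decomposition {d : ℕ} {w e : EuclideanSpace ℝ (Fin d)} (hw : ‖w‖ = 1) {δ : ℝ}
    (hδ0 : 0 < δ) (he : ‖e‖ ≤ δ) {n : ℕ} (hn : 1 / δ ≤ n) :
    ∃ k ∈ Finset.Icc (-n : ℤ) n, ∃ u : EuclideanSpace ℝ (Fin d), ∃ ρ : ℝ,
      ⟪u, w⟫ = 0 ∧ ‖u‖ ≤ δ ∧ 0 ≤ ρ ∧ ρ ≤ δ ^ 2 ∧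
        e = u + ρ • w + ((k : ℝ) * δ ^ 2) • w := by
  set a := ⟪e, w⟫ with ha
  have hww : ⟪w, w⟫ = 1 := by rw [real_inner_self_eq_norm_sq, hw]; norm_num
  have hδ2 : 0 < δ ^ 2 := by positivity
  have habs : |a| ≤ δ := by
    have := abs_real_inner_le_norm e w
    rw [hw, mul_one] at this
    exact this.trans he
  obtain ⟨hal, hau⟩ := abs_le.1 habs
  have hδn : δ ≤ n * δ ^ 2 := by
    have := mul_le_mul_of_nonneg_right hn hδ2.le
    calc δ = 1 / δ * δ ^ 2 := by field_simp
      _ ≤ _ := this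
  have hfl := Int.floor_le (a / δ ^ 2)
  have hfl' := Int.lt_floor_add_one (a / δ ^ 2)
  rw [le_div_iff₀ hδ2] at hfl
  rw [div_lt_iff₀ hδ2] at hfl'
  refine ⟨⌊a / δ ^ 2⌋, ?_, e - a • w, a - ⌊a / δ ^ 2⌋ * δ ^ 2, ?_, ?_, by linarith, by linarith,
    by module⟩
  · rw [Finset.mem_Icc]
    constructor
    · rw [Int.le_floor, le_div_iff₀ hδ2]
      push_cast
      linarith
    · have : (⌊a / δ ^ 2⌋ : ℝ) ≤ (n : ℤ) := by
        push_cast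
        exact le_of_mul_le_mul_right (by linarith) hδ2
      exact_mod_cast this
  · rw [inner_sub_left, real_inner_smul_left, hww, ← ha]
    ring
  · refine le_trans ?_ he
    refine abs_le_of_sq_le_sq' ?_ (norm_nonneg _) |>.2
    rw [norm_sub_sq_real, real_inner_smul_right, norm_smul, hw, ← ha, Real.norm_eq_abs, mul_one,
      sq_abs]
    nlinarith [sq_nonneg a]

/-- Volume of the `δ`-neighbourhood of the set of unit vectors in a multiple of a symmetric convex
body `M` that contains a flat ellipsoid-like set with half-axes `δ` and `δ ^ 2`. -/
lemma volume_unit_directions_le {d : ℕ} {M : Set (EuclideanSpace ℝ (Fin d))}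
    (hM : Convex ℝ M) (hMc : IsCompact M) {w : EuclideanSpace ℝ (Fin d)} (hw : ‖w‖ = 1)
    {δ s : ℝ} (hδ0 : 0 < δ) (hδ1 : δ ≤ 1 / 4) (hs : 0 < s)
    (hdisc : ∀ u, ⟪u, w⟫ = 0 → ‖u‖ ≤ δ → u ∈ M) (hthick : δ ^ 2 • w ∈ M) :
    volume {y | ∃ v, ‖v‖ = 1 ∧ s • v ∈ M ∧ ‖y - v‖ ≤ δ} ≤
      ENNReal.ofReal (15 * d * (s⁻¹ + 2) ^ d) * volume M := by
  have h0 : (0 : EuclideanSpace ℝ (Fin d)) ∈ M := hdisc 0 (by simp) (by simpa using hδ0.le)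
  have hs' : 0 < s⁻¹ := by positivity
  set L := s⁻¹ • M + closedBall (0 : EuclideanSpace ℝ (Fin d)) δ
  have hLc : IsCompact L := (hMc.smul _).add (isCompact_closedBall _ _)
  have hLconv : Convex ℝ L := (hM.smul _).add (convex_closedBall _ _)
  have h0L : (0 : EuclideanSpace ℝ (Fin d)) ∈ L :=
    ⟨0, ⟨0, h0, smul_zero _⟩, 0, mem_closedBall_self hδ0.le, add_zero _⟩
  set L' := L ∩ closedBall (0 : EuclideanSpace ℝ (Fin d)) (1 + δ)
  have hsub : {y | ∃ v, ‖v‖ = 1 ∧ s • v ∈ M ∧ ‖y - v‖ ≤ δ} ⊆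
      L' \ AffineMap.homothety (0 : EuclideanSpace ℝ (Fin d)) (1 - 3 * δ) '' L' := by
    rintro y ⟨v, hv, hvM, hyv⟩
    refine ⟨⟨⟨v, ⟨s • v, hvM, by simp [smul_smul, hs.ne']⟩, y - v, by simpa using hyv, by simp⟩,
      ?_⟩, ?_⟩
    · rw [mem_closedBall_zero_iff]
      have := norm_add_le v (y - v)
      rw [add_sub_cancel] at this
      linarith
    · rintro ⟨x, hx, rfl⟩
      have hx2 : ‖x‖ ≤ 1 + δ := by simpa using hx.2
      rw [AffineMap.homothety_apply] at hyv
      simp only [vsub_eq_sub, sub_zero, vadd_eq_add, add_zero] at hyv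
      have h1 := norm_sub_norm_le v ((1 - 3 * δ) • x)
      rw [norm_sub_rev, norm_smul, Real.norm_eq_abs, abs_of_nonneg (by linarith), hv] at h1
      nlinarith
  have hL'vol : volume L' ≤ volume L := measure_mono inter_subset_left
  obtain ⟨n, hn1, hn2⟩ : ∃ n : ℕ, 1 / δ ≤ n ∧ (n : ℝ) ≤ 1 / δ + 1 :=
    ⟨⌈1 / δ⌉₊, Nat.le_ceil _, (Nat.ceil_lt_add_one (by positivity)).le⟩
  have hcov : L ⊆ ⋃ k ∈ Finset.Icc (-n : ℤ) n, (((k : ℝ) * δ ^ 2) • w) +ᵥ ((s⁻¹ + 2) • M) := by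
    rintro _ ⟨_, ⟨m, hm, rfl⟩, e, he, rfl⟩
    rw [mem_closedBall_zero_iff] at he
    obtain ⟨k, hk, u, ρ, hu0, hu, hρ0, hρ, rfl⟩ := exists_slab_decomposition hw hδ0 he hn1
    refine mem_iUnion₂.2 ⟨k, hk, ?_⟩
    refine ⟨s⁻¹ • m + (u + ρ • w), ?_, by simp only [vadd_eq_add]; abel⟩
    have hρM : ρ • w ∈ M := by
      have := hM.smul_mem_of_zero_mem h0 hthick
        (t := ρ / δ ^ 2) ⟨by positivity, (div_le_one (by positivity)).2 hρ⟩
      rwa [smul_smul, div_mul_cancel₀ _ (by positivity)] at this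
    rw [hM.add_smul hs'.le zero_le_two]
    refine add_mem_add (smul_mem_smul_set hm) ?_
    have h2M := hM.add_smul zero_le_one zero_le_one
    rw [one_smul, one_add_one_eq_two] at h2M
    rw [h2M]
    exact add_mem_add (hdisc u hu0 hu) hρM
  have hvolL : volume L ≤ ENNReal.ofReal (5 / δ * (s⁻¹ + 2) ^ d) * volume M := by
    calc volume L ≤ ∑ k ∈ Finset.Icc (-n : ℤ) n,
          volume ((((k : ℝ) * δ ^ 2) • w) +ᵥ ((s⁻¹ + 2) • M)) :=
          (measure_mono hcov).trans (measure_biUnion_finset_le _ _)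
      _ = (2 * n + 1 : ℕ) * (ENNReal.ofReal ((s⁻¹ + 2) ^ d) * volume M) := by
          simp only [measure_vadd, Measure.addHaar_smul, finrank_euclideanSpace_fin]
          rw [abs_of_nonneg (by positivity), Finset.sum_const, nsmul_eq_mul]
          congr 2
          simp
          omega
      _ ≤ _ := by
          rw [← mul_assoc, ← ENNReal.ofReal_natCast, ← ENNReal.ofReal_mul (by positivity)]
          gcongr
          push_cast
          have : 4 ≤ 1 / δ := by rw [le_div_iff₀ hδ0]; linarith
          have : 5 / δ = 5 * (1 / δ) := by ring
          linarith
  calc volume {y | ∃ v, ‖v‖ = 1 ∧ s • v ∈ M ∧ ‖y - v‖ ≤ δ}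
      ≤ volume (L' \ AffineMap.homothety (0 : EuclideanSpace ℝ (Fin d)) (1 - 3 * δ) '' L') :=
        measure_mono hsub
    _ ≤ ENNReal.ofReal (d * (1 - (1 - 3 * δ))) * volume L' :=
        volume_diff_homothety_le (hLconv.inter (convex_closedBall _ _))
          (hLc.inter (isCompact_closedBall _ _))
          ⟨h0L, mem_closedBall_self (by linarith)⟩ (by linarith) (by linarith)
    _ ≤ ENNReal.ofReal (d * (1 - (1 - 3 * δ))) *
          (ENNReal.ofReal (5 / δ * (s⁻¹ + 2) ^ d) * volume M) := by
        gcongr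
        exact hL'vol.trans hvolL
    _ = _ := by
        rw [← mul_assoc, ← ENNReal.ofReal_mul (by rw [sub_sub_cancel]; positivity)]
        congr 2
        field_simp
        ring

/-- A unit vector nearly orthogonal to all short vectors orthogonal to `w` is close to `± w`. -/
lemma norm_sub_le_or_norm_add_le {d : ℕ} {w w' : EuclideanSpace ℝ (Fin d)} (hw : ‖w‖ = 1)
    (hw' : ‖w'‖ = 1) {δ : ℝ} (hδ0 : 0 < δ)
    (h : ∀ u, ⟪u, w⟫ = 0 → ‖u‖ ≤ δ → ⟪u, w'⟫ ≤ 3 * δ ^ 2) :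
    ‖w' - w‖ ≤ 6 * δ ∨ ‖w' + w‖ ≤ 6 * δ := by
  set a := ⟪w', w⟫ with ha
  have hww : ⟪w, w⟫ = 1 := by rw [real_inner_self_eq_norm_sq, hw]; norm_num
  set t := w' - a • w with ht
  have htw : ⟪t, w⟫ = 0 := by
    rw [ht, inner_sub_left, real_inner_smul_left, hww, ← ha]
    ring
  have hw't : w' = t + a • w := by rw [ht]; abel
  have htt : ⟪t, w'⟫ = ‖t‖ ^ 2 := by
    rw [hw't, inner_add_right, real_inner_smul_right, htw, real_inner_self_eq_norm_sq]
    ring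
  have htn : ‖t‖ ≤ 3 * δ := by
    rcases eq_or_ne ‖t‖ 0 with h0 | h0
    · rw [h0]
      positivity
    have hpos : 0 < ‖t‖ := lt_of_le_of_ne (norm_nonneg _) (Ne.symm h0)
    have := h ((δ / ‖t‖) • t) (by rw [real_inner_smul_left, htw, mul_zero]) (by
      rw [norm_smul, Real.norm_eq_abs, abs_of_pos (by positivity), div_mul_cancel₀ _ h0])
    rw [real_inner_smul_left, htt, div_mul_eq_mul_div, div_le_iff₀ hpos] at this
    have h2 : δ * ‖t‖ * ‖t‖ ≤ δ * ‖t‖ * (3 * δ) := by nlinarith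
    exact le_of_mul_le_mul_left h2 (by positivity)
  have hsq : 1 = ‖t‖ ^ 2 + a ^ 2 := by
    have h1 : ‖w'‖ ^ 2 = ‖t‖ ^ 2 + a ^ 2 := by
      conv_lhs => rw [hw't]
      rw [norm_add_sq_real, real_inner_smul_right, htw, norm_smul, hw, Real.norm_eq_abs, mul_one,
        sq_abs]
      ring
    rw [← h1, hw']
    norm_num
  rcases le_total 0 a with h0 | h0
  · left
    have : w' - w = t + (a - 1) • w := by rw [ht]; module
    rw [this]
    refine (norm_add_le _ _).trans ?_
    rw [norm_smul, hw, mul_one, Real.norm_eq_abs]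
    have : |a - 1| ≤ ‖t‖ := by
      rw [abs_le]
      constructor <;> nlinarith [norm_nonneg t]
    linarith
  · right
    have : w' + w = t + (a + 1) • w := by rw [ht]; module
    rw [this]
    refine (norm_add_le _ _).trans ?_
    rw [norm_smul, hw, mul_one, Real.norm_eq_abs]
    have : |a + 1| ≤ ‖t‖ := by
      rw [abs_le]
      constructor <;> nlinarith [norm_nonneg t]
    linarith

/-! ### Economic covering by Macbeath regions -/

/-- `z` is the centre of a Macbeath region of height `δ ^ 2` of `P` near a boundary point with
outer normal `w`; the region contains a segment of direction `v` and half-length `s`, and a disc of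
radius `δ` orthogonal to `w`. -/
structure IsCapCentre {d : ℕ} (P : Set (EuclideanSpace ℝ (Fin d))) (s δ : ℝ)
    (v w z : EuclideanSpace ℝ (Fin d)) : Prop where
  norm_dir : ‖v‖ = 1
  norm_normal : ‖w‖ = 1
  segment_mem : s • v ∈ macbeath P z
  inner_le : ∀ y ∈ P, ⟪y, w⟫ ≤ ⟪z, w⟫ + δ ^ 2
  disc_mem : ∀ u, ⟪u, w⟫ = 0 → ‖u‖ ≤ δ → u ∈ macbeath P z
  ball_subset : closedBall 0 (δ ^ 2) ⊆ macbeath P z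

section IsCapCentre

variable {d : ℕ} {P : Set (EuclideanSpace ℝ (Fin d))} {s δ : ℝ}
  {v w z v' w' z' p : EuclideanSpace ℝ (Fin d)}

/-- Macbeath regions of height `δ ^ 2` lie in a thin shell below the boundary. -/
lemma IsCapCentre.vadd_subset_shell (h : IsCapCentre P s δ v w z) (hP : Convex ℝ P)
    (hp : closedBall p 1 ⊆ P) (hδ0 : 0 < δ) (hδ1 : δ ≤ 1 / 4) :
    z +ᵥ (1 / 2 : ℝ) • macbeath P z ⊆ P \ AffineMap.homothety p (1 - 3 * δ ^ 2) '' P := by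
  rintro _ ⟨_, ⟨u, hu, rfl⟩, rfl⟩
  have hz : z ∈ P := by simpa using (h.ball_subset (mem_closedBall_self (by positivity))).1
  have hww : ⟪w, w⟫ = 1 := by rw [real_inner_self_eq_norm_sq, h.norm_normal]; norm_num
  refine ⟨?_, ?_⟩
  · convert hP hz hu.1 (a := 1 / 2) (b := 1 / 2) (by norm_num) (by norm_num) (by norm_num) using 1
    simp only [vadd_eq_add]
    module
  · rintro ⟨k, hk, hkz⟩
    have h1 := h.inner_le k hk
    have h2 := h.inner_le (p + w) (hp (by simp [h.norm_normal]))
    have h3 := h.inner_le _ hu.2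
    rw [inner_add_left, hww] at h2
    rw [inner_sub_left] at h3
    have h4 := congrArg (fun y => ⟪y, w⟫) hkz
    simp only [AffineMap.homothety_apply, vsub_eq_sub, vadd_eq_add, inner_add_left,
      inner_sub_left, real_inner_smul_left] at h4
    have hδ2 : δ ^ 2 ≤ 1 / 16 := by nlinarith
    have hδ2' : 0 < δ ^ 2 := by positivity
    nlinarith [mul_le_mul_of_nonneg_left h1 (by linarith : 0 ≤ 1 - 3 * δ ^ 2),
      mul_le_mul_of_nonneg_left h2 (by linarith : 0 ≤ 3 * δ ^ 2)]

lemma IsCapCentre.interior_nonempty (h : IsCapCentre P s δ v w z) (hδ0 : 0 < δ) :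
    (interior (z +ᵥ (1 / 2 : ℝ) • macbeath P z)).Nonempty := by
  refine ⟨z, mem_interior_iff_mem_nhds.2 (Filter.mem_of_superset
    (closedBall_mem_nhds z (ε := δ ^ 2 / 2) (by positivity)) fun y hy => ?_)⟩
  rw [mem_closedBall, dist_eq_norm] at hy
  refine ⟨y - z, ⟨(2 : ℝ) • (y - z), h.ball_subset ?_, ?_⟩, by simp⟩
  · rw [mem_closedBall_zero_iff, norm_smul, Real.norm_two]
    linarith
  · simp [smul_smul]

lemma volume_macbeath (z : EuclideanSpace ℝ (Fin d)) :
    volume (macbeath P z) =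
      ENNReal.ofReal (2 ^ d) * volume (z +ᵥ (1 / 2 : ℝ) • macbeath P z) := by
  rw [measure_vadd, Measure.addHaar_smul, finrank_euclideanSpace_fin,
    abs_of_nonneg (by positivity), ← mul_assoc, ← ENNReal.ofReal_mul (by positivity), ← mul_pow]
  norm_num

lemma IsCapCentre.compare (h : IsCapCentre P s δ v w z) (h' : IsCapCentre P s δ v' w' z')
    (hP : Convex ℝ P) (hδ0 : 0 < δ)
    (hne : ((z +ᵥ (1 / 2 : ℝ) • macbeath P z) ∩
      (z' +ᵥ (1 / 2 : ℝ) • macbeath P z')).Nonempty) :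
    (s / 3) • v ∈ macbeath P z' ∧ (‖w - w'‖ ≤ 6 * δ ∨ ‖w + w'‖ ≤ 6 * δ) := by
  obtain ⟨_, ⟨_, ⟨a, ha, rfl⟩, rfl⟩, _, ⟨a', ha', rfl⟩, haa⟩ := hne
  simp only [vadd_eq_add] at haa
  constructor
  · have := macbeath_compare hP ha' ha haa h.segment_mem
    rwa [smul_smul, one_div, inv_mul_eq_div] at this
  · refine norm_sub_le_or_norm_add_le h'.norm_normal h.norm_normal hδ0 fun u hu0 hu => ?_
    have h1 := macbeath_compare hP ha ha' haa.symm (h'.disc_mem u hu0 hu)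
    have h2 := h.inner_le _ h1.1
    rw [inner_add_left, real_inner_smul_left] at h2
    linarith

/-- The economic covering: the `δ`-neighbourhood of the set of pairs of a direction and a normal
of a cap has volume of order `δ ^ (d + 2)`. -/
lemma exists_volume_capCentre_le (hP : Convex ℝ P) (hPc : IsCompact P)
    (hp : closedBall p 1 ⊆ P) (hs : 0 < s) :
    ∃ C : ℝ, ∀ δ : ℝ, 0 < δ → δ ≤ 1 / 4 →
      volume {q : EuclideanSpace ℝ (Fin (d + d)) | ∃ v w z, IsCapCentre P s δ v w z ∧
        ‖fstE q - v‖ ≤ δ ∧ ‖sndE q - w‖ ≤ δ} ≤ ENNReal.ofReal (C * δ ^ (d + 2)) := by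
  set β := volume (closedBall (0 : EuclideanSpace ℝ (Fin d)) 1)
  have hβfin : β ≠ ⊤ := (isCompact_closedBall _ _).measure_ne_top
  set C₁ : ℝ := 15 * d * ((s / 3)⁻¹ + 2) ^ d
  have hC₁0 : 0 ≤ C₁ := by positivity
  refine ⟨C₁ * 2 ^ d * (2 * 7 ^ d * β.toReal) * (3 * d * (volume P).toReal),
    fun δ hδ0 hδ1 => ?_⟩
  set B : EuclideanSpace ℝ (Fin d) × EuclideanSpace ℝ (Fin d) × EuclideanSpace ℝ (Fin d) →
    Set (EuclideanSpace ℝ (Fin d)) := fun i => i.2.2 +ᵥ (1 / 2 : ℝ) • macbeath P i.2.2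
  have hmc : ∀ z, IsCompact (macbeath P z) := fun z =>
    (hPc.vadd (-z)).of_isClosed_subset (isClosed_macbeath hPc.isClosed z) (macbeath_subset_vadd P z)
  obtain ⟨I, hIt, hdisj, hcov⟩ := Vitali.exists_disjoint_subfamily_covering_enlargement B
    {i | IsCapCentre P s δ i.1 i.2.1 i.2.2} (fun _ => 1) 2 one_lt_two (fun _ _ => zero_le_one) 1
    (fun _ _ => le_rfl) (fun i hi => (hi.interior_nonempty hδ0).mono interior_subset)
  have hcount : I.Countable :=
    hdisj.countable_of_nonempty_interior fun i hi => (hIt hi).interior_nonempty hδ0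
  have hsum : ∑' i : I, volume (B i) ≤ ENNReal.ofReal (3 * d * δ ^ 2) * volume P := by
    rw [← measure_biUnion hcount hdisj fun i _ =>
      (((hmc _).smul _).vadd _).isClosed.measurableSet]
    have hδ2 : δ ^ 2 ≤ 1 / 16 := by nlinarith
    refine (measure_mono (iUnion₂_subset fun i hi =>
      (hIt hi).vadd_subset_shell hP hp hδ0 hδ1)).trans
      ((volume_diff_homothety_le hP hPc (hp (mem_closedBall_self zero_le_one))
        (by linarith) (by nlinarith)).trans_eq ?_)
    congr 2
    ring
  set A : EuclideanSpace ℝ (Fin d) × EuclideanSpace ℝ (Fin d) × EuclideanSpace ℝ (Fin d) →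
    Set (EuclideanSpace ℝ (Fin d)) := fun i =>
      {y | ∃ v, ‖v‖ = 1 ∧ (s / 3) • v ∈ macbeath P i.2.2 ∧ ‖y - v‖ ≤ δ}
  have hsub : {q : EuclideanSpace ℝ (Fin (d + d)) | ∃ v w z, IsCapCentre P s δ v w z ∧
      ‖fstE q - v‖ ≤ δ ∧ ‖sndE q - w‖ ≤ δ} ⊆
      ⋃ i ∈ I, {q | fstE q ∈ A i ∧
        sndE q ∈ closedBall i.2.1 (7 * δ) ∪ closedBall (-i.2.1) (7 * δ)} := by
    rintro q ⟨v, w, z, h, hqv, hqw⟩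
    obtain ⟨i, hi, hne, -⟩ := hcov (v, w, z) h
    obtain ⟨h1, h2⟩ := h.compare (hIt hi) hP hδ0 hne
    refine mem_iUnion₂.2 ⟨i, hi, ⟨v, h.norm_dir, h1, hqv⟩, ?_⟩
    refine h2.imp (fun h2 => ?_) fun h2 => ?_
    · rw [mem_closedBall, dist_eq_norm, ← sub_add_sub_cancel _ w]
      exact (norm_add_le _ _).trans (by linarith)
    · rw [mem_closedBall, dist_eq_norm, ← sub_add_sub_cancel _ w, sub_neg_eq_add w]
      exact (norm_add_le _ _).trans (by linarith)
  have hcell : ∀ i ∈ I, volume {q : EuclideanSpace ℝ (Fin (d + d)) | fstE q ∈ A i ∧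
      sndE q ∈ closedBall i.2.1 (7 * δ) ∪ closedBall (-i.2.1) (7 * δ)} ≤
      ENNReal.ofReal (C₁ * 2 ^ d) * (2 * (ENNReal.ofReal ((7 * δ) ^ d) * β)) *
        volume (B i) := by
    intro i hi
    have h := hIt hi
    have hAi : volume (A i) ≤ ENNReal.ofReal C₁ * volume (macbeath P i.2.2) :=
      volume_unit_directions_le (convex_macbeath hP _) (hmc _) h.norm_normal hδ0 hδ1
        (by positivity) h.disc_mem (h.ball_subset (by
          rw [mem_closedBall_zero_iff, norm_smul, h.norm_normal, mul_one, Real.norm_eq_abs,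
            abs_of_nonneg (by positivity)]))
    have hW : volume (closedBall i.2.1 (7 * δ) ∪ closedBall (-i.2.1) (7 * δ)) ≤
        2 * (ENNReal.ofReal ((7 * δ) ^ d) * β) := by
      refine (measure_union_le _ _).trans_eq ?_
      rw [Measure.addHaar_closedBall' _ i.2.1 (by positivity),
        Measure.addHaar_closedBall' _ (-i.2.1) (by positivity), finrank_euclideanSpace_fin, two_mul]
    refine (volume_fstE_sndE_le _ _).trans ((mul_le_mul' hAi hW).trans_eq ?_)
    rw [volume_macbeath, ENNReal.ofReal_mul hC₁0]
    ring
  calc _ ≤ ∑' i : I, volume {q : EuclideanSpace ℝ (Fin (d + d)) | fstE q ∈ A i ∧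
        sndE q ∈ closedBall i.1.2.1 (7 * δ) ∪ closedBall (-i.1.2.1) (7 * δ)} :=
        (measure_mono hsub).trans (measure_biUnion_le _ hcount _)
    _ ≤ ∑' i : I, ENNReal.ofReal (C₁ * 2 ^ d) * (2 * (ENNReal.ofReal ((7 * δ) ^ d) * β)) *
        volume (B i) := ENNReal.tsum_le_tsum fun i => hcell i i.2
    _ ≤ ENNReal.ofReal (C₁ * 2 ^ d) * (2 * (ENNReal.ofReal ((7 * δ) ^ d) * β)) *
        (ENNReal.ofReal (3 * d * δ ^ 2) * volume P) := by
        rw [ENNReal.tsum_mul_left]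
        gcongr
    _ = _ := by
        rw [show C₁ * 2 ^ d * (2 * 7 ^ d * β.toReal) * (3 * d * (volume P).toReal) * δ ^ (d + 2) =
          C₁ * 2 ^ d * (2 * ((7 * δ) ^ d * β.toReal)) * (3 * d * δ ^ 2 * (volume P).toReal) by ring,
          ENNReal.ofReal_mul (p := C₁ * 2 ^ d * (2 * ((7 * δ) ^ d * β.toReal))) (by positivity),
          ENNReal.ofReal_mul (p := C₁ * 2 ^ d) (by positivity),
          ENNReal.ofReal_mul zero_le_two, ENNReal.ofReal_mul (p := (7 * δ) ^ d) (by positivity),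
          ENNReal.ofReal_mul (p := 3 * d * δ ^ 2) (by positivity), ENNReal.ofReal_toReal hβfin,
          ENNReal.ofReal_toReal hPc.measure_ne_top, ENNReal.ofReal_ofNat]

end IsCapCentre

/-- A long segment of `K` with common outer normal `w` gives rise to a cap centre of the outer
parallel body of `K`. -/
lemma isCapCentre_of_segment {d : ℕ} {K : Set (EuclideanSpace ℝ (Fin d))} (hK : Convex ℝ K)
    {x y w : EuclideanSpace ℝ (Fin d)} (hx : x ∈ K) (hy : y ∈ K) (hw : ‖w‖ = 1)
    (hsupp : ∀ z ∈ segment ℝ x y, ∀ k ∈ K, ⟪k, w⟫ ≤ ⟪z, w⟫) {s δ : ℝ} (hs : 0 < s)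
    (hsxy : 2 * s ≤ ‖y - x‖) (hδ0 : 0 < δ) (hδ1 : δ ≤ 1 / 4) :
    IsCapCentre (K + closedBall 0 1) s δ (‖y - x‖⁻¹ • (y - x)) w
      (midpoint ℝ x y + (1 - δ ^ 2) • w) := by
  have hpos : 0 < ‖y - x‖ := by linarith
  have hδ2 : δ ^ 2 ≤ 1 / 16 := by nlinarith
  have hδ2' : 0 < δ ^ 2 := by positivity
  have hww : ⟪w, w⟫ = 1 := by rw [real_inner_self_eq_norm_sq, hw]; norm_num
  have hm : midpoint ℝ x y ∈ K := hK.segment_subset hx hy (midpoint_mem_segment x y)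
  have hmac : ∀ u, ‖(1 - δ ^ 2) • w + u‖ ≤ 1 → ‖(1 - δ ^ 2) • w - u‖ ≤ 1 →
      u ∈ macbeath (K + closedBall 0 1) (midpoint ℝ x y + (1 - δ ^ 2) • w) := by
    intro u h1 h2
    exact ⟨⟨_, hm, _, mem_closedBall_zero_iff.2 h1, (add_assoc _ _ _).symm⟩,
      ⟨_, hm, _, mem_closedBall_zero_iff.2 h2, (add_sub_assoc _ _ _).symm⟩⟩
  have hnw : ‖(1 - δ ^ 2) • w‖ = 1 - δ ^ 2 := by
    rw [norm_smul, hw, mul_one, Real.norm_eq_abs, abs_of_nonneg (by linarith)]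
  refine ⟨?_, hw, ?_, ?_, ?_, ?_⟩
  · rw [norm_smul, norm_inv, norm_norm, inv_mul_cancel₀ hpos.ne']
  · have hseg : ∀ t : ℝ, |t| ≤ 1 / 2 → midpoint ℝ x y + t • (y - x) ∈ K := by
      intro t ht
      obtain ⟨h1, h2⟩ := abs_le.1 ht
      have : midpoint ℝ x y + t • (y - x) = (1 / 2 - t) • x + (1 / 2 + t) • y := by
        rw [midpoint_eq_smul_add, invOf_eq_inv]
        module
      rw [this]
      exact hK hx hy (by linarith) (by linarith) (by ring)
    have ht : s * ‖y - x‖⁻¹ ≤ 1 / 2 := by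
      rw [← div_eq_mul_inv, div_le_iff₀ hpos]
      linarith
    have ht' : |s * ‖y - x‖⁻¹| ≤ 1 / 2 := by rwa [abs_of_nonneg (by positivity)]
    have hwb : (1 - δ ^ 2) • w ∈ closedBall (0 : EuclideanSpace ℝ (Fin d)) 1 := by
      rw [mem_closedBall_zero_iff, hnw]
      linarith
    refine ⟨⟨_, hseg _ ht', _, hwb, ?_⟩,
      ⟨_, hseg (-(s * ‖y - x‖⁻¹)) (by rwa [abs_neg]), _, hwb, ?_⟩⟩
    · simp only [smul_smul]
      abel
    · simp only [smul_smul, neg_smul]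
      abel
  · rintro _ ⟨k, hk, b, hb, rfl⟩
    rw [mem_closedBall_zero_iff] at hb
    have h1 := hsupp _ (midpoint_mem_segment x y) k hk
    have h2 := (real_inner_le_norm b w).trans_eq (by rw [hw, mul_one])
    simp only [inner_add_left, real_inner_smul_left, hww]
    linarith
  · intro u hu0 hu
    have hu' : ⟪(1 - δ ^ 2) • w, u⟫ = 0 := by
      rw [real_inner_smul_left, real_inner_comm, hu0, mul_zero]
    have hu2 : ‖u‖ ^ 2 ≤ δ ^ 2 := by gcongr
    apply hmac
    · refine (sq_le_one_iff₀ (norm_nonneg _)).1 ?_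
      rw [norm_add_sq_real, hu', hnw]
      nlinarith
    · refine (sq_le_one_iff₀ (norm_nonneg _)).1 ?_
      rw [norm_sub_sq_real, hu', hnw]
      nlinarith
  · intro u hu
    rw [mem_closedBall_zero_iff] at hu
    apply hmac
    · exact (norm_add_le _ _).trans (by linarith)
    · exact (norm_sub_le _ _).trans (by linarith)

/-- A volume bound for neighbourhoods gives a bound for the upper Minkowski content. -/
lemma minkContent_lt_top {D : ℕ} {m : ℝ} {k : ℕ} (hk : m - D = -(k : ℝ))
    {S : Set (EuclideanSpace ℝ (Fin D))} {C : ℝ}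
    (hS : ∀ δ : ℝ, 0 < δ → δ ≤ 1 / 4 → volume (thickening δ S) ≤ ENNReal.ofReal (C * δ ^ k)) :
    minkContent m S < ⊤ := by
  refine lt_of_le_of_lt (b := ENNReal.ofReal C) (limsup_le_of_le (by isBoundedDefault) ?_)
    ENNReal.ofReal_lt_top
  filter_upwards [Ioc_mem_nhdsGT (show (0 : ℝ) < 1 / 8 by norm_num)] with ε hε
  have h0 : 0 < 2 * ε := by linarith [hε.1]
  calc ENNReal.ofReal ((2 * ε) ^ (m - (D : ℝ))) * volume (cthickening ε S)
      ≤ ENNReal.ofReal ((2 * ε) ^ (m - (D : ℝ))) * ENNReal.ofReal (C * (2 * ε) ^ k) := by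
        gcongr
        exact (measure_mono (cthickening_subset_thickening' h0 (by linarith [hε.1]) S)).trans
          (hS _ h0 (by linarith [hε.2]))
    _ = ENNReal.ofReal C := by
        rw [← ENNReal.ofReal_mul (by positivity), hk, Real.rpow_neg h0.le, Real.rpow_natCast]
        congr 1
        field_simp

/-- Theorem A: for a closed convex `K ⊆ ℝ^d` (`d ≥ 2`), the set `T_K` of pairs `(v, w)` where `v`
is the direction of a nondegenerate segment in `∂K` and `w` is the outward unit normal of a
supporting hyperplane of `K` containing that segment, viewed in `ℝ^{2d}`, is a countable union of
sets each of finite `(d-2)`-dimensional upper Minkowski content. -/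
theorem statement0 {d : ℕ} (hd : 2 ≤ d) (K : Set (EuclideanSpace ℝ (Fin d)))
    (hKcl : IsClosed K) (hKconv : Convex ℝ K) :
    ∃ F : ℕ → Set (EuclideanSpace ℝ (Fin (d + d))),
      {q : EuclideanSpace ℝ (Fin (d + d)) |
          ∃ x y : EuclideanSpace ℝ (Fin d), x ≠ y ∧ segment ℝ x y ⊆ frontier K ∧
            ∃ w, (∀ z ∈ segment ℝ x y, w ∈ nor K z) ∧
              q = appendE (‖y - x‖⁻¹ • (y - x)) w}
        = ⋃ i, F i ∧
      ∀ i, minkContent ((d : ℝ) - 2) (F i) < ⊤ := by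
  let F : ℕ → Set (EuclideanSpace ℝ (Fin (d + d))) := fun i =>
    {q | ∃ x y : EuclideanSpace ℝ (Fin d), (x ≠ y ∧ segment ℝ x y ⊆ frontier K ∧
      ∃ w, (∀ z ∈ segment ℝ x y, w ∈ nor K z) ∧ q = appendE (‖y - x‖⁻¹ • (y - x)) w) ∧
      1 / ((i : ℝ) + 1) ≤ ‖y - x‖ ∧ ‖x‖ ≤ i ∧ ‖y‖ ≤ i}
  refine ⟨F, ?_, fun i => ?_⟩
  · ext q
    simp only [F, mem_iUnion, mem_ofPred_eq]
    constructor
    · rintro ⟨x, y, h⟩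
      obtain ⟨n, hn⟩ := exists_nat_ge (max (1 / ‖y - x‖) (max ‖x‖ ‖y‖))
      have hpos : 0 < ‖y - x‖ := norm_pos_iff.2 (sub_ne_zero.2 h.1.symm)
      refine ⟨n, x, y, h, ?_, ?_, ?_⟩
      · rw [one_div_le (by positivity) hpos]
        linarith [(le_max_left _ _).trans hn]
      · exact ((le_max_left _ _).trans (le_max_right _ _)).trans hn
      · exact ((le_max_right _ _).trans (le_max_right _ _)).trans hn
    · rintro ⟨_, x, y, h, -⟩
      exact ⟨x, y, h⟩
  · rcases (F i).eq_empty_or_nonempty with hF | hF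
    · refine minkContent_lt_top (k := d + 2) (C := 0) (by push_cast; ring) fun δ _ _ => ?_
      simp [hF]
    set K' := K ∩ closedBall (0 : EuclideanSpace ℝ (Fin d)) i
    have hK'conv : Convex ℝ K' := hKconv.inter (convex_closedBall _ _)
    have hK'c : IsCompact K' := (isCompact_closedBall _ _).inter_left hKcl
    have hmem : ∀ {x y : EuclideanSpace ℝ (Fin d)}, segment ℝ x y ⊆ frontier K →
        ‖x‖ ≤ i → ‖y‖ ≤ i → x ∈ K' ∧ y ∈ K' := fun hseg hx hy =>
      ⟨⟨hKcl.frontier_subset (hseg (left_mem_segment _ _ _)), mem_closedBall_zero_iff.2 hx⟩,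
        ⟨hKcl.frontier_subset (hseg (right_mem_segment _ _ _)), mem_closedBall_zero_iff.2 hy⟩⟩
    obtain ⟨_, p, p', ⟨_, hseg, _⟩, _, hpx, hpy⟩ := hF
    have hp : closedBall p 1 ⊆ K' + closedBall (0 : EuclideanSpace ℝ (Fin d)) 1 := fun y hy =>
      ⟨p, (hmem hseg hpx hpy).1, y - p, by simpa [dist_eq_norm] using hy, by simp⟩
    have hs : 0 < 1 / (2 * ((i : ℝ) + 1)) := by positivity
    obtain ⟨C, hC⟩ := exists_volume_capCentre_le (hK'conv.add (convex_closedBall _ _))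
      (hK'c.add (isCompact_closedBall _ _)) hp hs
    refine minkContent_lt_top (k := d + 2) (C := C) (by push_cast; ring) fun δ hδ0 hδ1 =>
      (measure_mono fun q hq => ?_).trans (hC δ hδ0 hδ1)
    obtain ⟨_, ⟨x, y, ⟨hxy, hseg, w, hw, rfl⟩, hlen, hx, hy⟩, hdist⟩ := mem_thickening_iff.1 hq
    obtain ⟨hxK, hyK⟩ := hmem hseg hx hy
    refine ⟨_, w, _, isCapCentre_of_segment hK'conv hxK hyK
      (hw x (left_mem_segment _ _ _)).1 (fun z hz k hk => ?_) hs ?_ hδ0 hδ1, ?_, ?_⟩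
    · rw [real_inner_comm, real_inner_comm w z]
      exact (hw z hz).2 k hk.1
    · refine le_trans (le_of_eq ?_) hlen
      field_simp
    · have := dist_fstE_le q (appendE (‖y - x‖⁻¹ • (y - x)) w)
      rw [fstE_appendE, dist_eq_norm] at this
      exact this.trans hdist.le
    · have := dist_sndE_le q (appendE (‖y - x‖⁻¹ • (y - x)) w)
      rw [sndE_appendE, dist_eq_norm] at this
      exact this.trans hdist.le
end

section
/- For every d ∈ ℕ there exists a constant C_d > 0 with the following property: for every convex body K ⊆ ℝ^d and every r with 0 < r ≤ width K, there exist M ∈ ℕ and points x₁, …, x_M ∈ ℝ^d such that K ⊆ ⋃_{i=1}^M B̄(x_i, r) and M · r^d ≤ C_d · λ_d(K), where λ_d denotes Lebesgue measure. -/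
open MeasureTheory Metric Filter Set Pointwise
open scoped RealInnerProductSpace ENNReal

/-- A convex set containing the origin is closed under subconvex combinations. -/
theorem Convex.sum_mem_of_zero_mem {E ι : Type*} [AddCommGroup E] [Module ℝ E] [Fintype ι]
    {K : Set E} (hK : Convex ℝ K) (h0 : (0 : E) ∈ K) {a : ι → ℝ} {v : ι → E}
    (ha : ∀ i, 0 ≤ a i) (hsum : ∑ i, a i ≤ 1) (hv : ∀ i, v i ∈ K) : ∑ i, a i • v i ∈ K := by
  have h := hK.sum_mem (t := Finset.univ) (w := fun o : Option ι => o.elim (1 - ∑ i, a i) a)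
    (z := fun o : Option ι => o.elim 0 v) ?_ ?_ ?_
  · simpa [Fintype.sum_option] using h
  · rintro (_ | i) -
    · simpa using hsum
    · exact ha i
  · simp [Fintype.sum_option]
  · rintro (_ | i) -
    · exact h0
    · exact hv i

/-- The Cramer rule for the coordinates with respect to a basis. -/
theorem Module.Basis.det_update_self {E ι : Type*} [AddCommGroup E] [Module ℝ E]
    [Fintype ι] [DecidableEq ι] (v : Module.Basis ι ℝ E) (i : ι) (x : E) :
    v.det (Function.update v i x) = v.repr x i := by
  rw [v.det_apply, v.toMatrix_update, v.toMatrix_self, ← Matrix.cramer_apply, Matrix.cramer_one]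
  rfl

/-- A compact spanning set contains a basis with respect to which all the coordinates of its
points lie in `[-1, 1]`. -/
theorem IsCompact.exists_basis_abs_repr_le_one {E : Type*} [NormedAddCommGroup E]
    [NormedSpace ℝ E] [FiniteDimensional ℝ E] {K : Set E} (hK : IsCompact K)
    (hspan : ⊤ ≤ Submodule.span ℝ K) {n : ℕ} (hn : Module.finrank ℝ E = n) :
    ∃ v : Module.Basis (Fin n) ℝ E,
      (∀ i, v i ∈ K) ∧ ∀ x ∈ K, ∀ i, |v.repr x i| ≤ 1 := by
  classical
  obtain ⟨b, hb⟩ : ∃ b : Module.Basis (Fin n) ℝ E, ∀ i, b i ∈ K := by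
    let b := Module.Basis.ofSpan hspan
    have : Fintype ((linearIndepOn_empty ℝ (id : E → E)).extend (Set.empty_subset K)) :=
      FiniteDimensional.fintypeBasisIndex b
    refine ⟨b.reindex (Fintype.equivFinOfCardEq ((Module.finrank_eq_card_basis b).symm.trans hn)),
      fun i => ?_⟩
    rw [Module.Basis.reindex_apply]
    exact Module.Basis.ofSpan_subset hspan (Set.mem_range_self _)
  have hcont : Continuous fun v : Fin n → E => |b.det v| := by
    simp only [Module.Basis.det_apply]
    refine (Continuous.matrix_det (continuous_matrix fun i j => ?_)).abs
    exact (LinearMap.continuous_of_finiteDimensional (b.coord i)).comp (continuous_apply j)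
  obtain ⟨v, hvK, hv⟩ := (isCompact_univ_pi fun _ : Fin n => hK).exists_isMaxOn
    ⟨b, fun i _ => hb i⟩ hcont.continuousOn
  have hpos : 0 < |b.det v| := by
    have h : |b.det b| ≤ |b.det v| := hv (fun i _ => hb i)
    rw [b.det_self, abs_one] at h
    exact one_pos.trans_le h
  obtain ⟨hli, hsp⟩ := (b.is_basis_iff_det).2 (isUnit_iff_ne_zero.2 (abs_pos.1 hpos))
  let e := Module.Basis.mk hli hsp.ge
  have he : ⇑e = v := Module.Basis.coe_mk hli hsp.ge
  refine ⟨e, fun i => by rw [he]; exact hvK i trivial, fun x hx i => ?_⟩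
  have hupd : |b.det (Function.update v i x)| ≤ |b.det v| := by
    refine hv fun j _ => ?_
    rcases eq_or_ne j i with rfl | hj
    · simpa using hx
    · simpa [hj] using hvK j trivial
  have hdet : b.det (Function.update v i x) = b.det v * e.repr x i := by
    rw [← e.det_update_self, ← he]
    exact congrArg (fun f => f (Function.update e i x)) (b.det.eq_smul_basis_det e)
  rw [hdet, abs_mul] at hupd
  exact le_of_mul_le_mul_left (by simpa using hupd) hpos

/-- A convex body whose width is at least `w` contains a ball of radius comparable to `w`. -/
theorem IsCompact.exists_closedBall_subset_of_width {E : Type*} [NormedAddCommGroup E]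
    [NormedSpace ℝ E] [FiniteDimensional ℝ E] {K : Set E} (hne : K.Nonempty) (hK : IsCompact K)
    (hc : Convex ℝ K) {w : ℝ} (hw : 0 < w)
    (hwidth : ∀ (f : E →L[ℝ] ℝ) (a b : ℝ), (∀ x ∈ K, f x ∈ Set.Icc a b) → w * ‖f‖ ≤ b - a) :
    ∃ z, closedBall z (w / (2 * (Module.finrank ℝ E * (Module.finrank ℝ E + 1)))) ⊆ K := by
  obtain ⟨p, hp⟩ := hne
  wlog hp0 : p = 0 generalizing K p
  · obtain ⟨z, hz⟩ := this (K := (fun x => -p + x) '' K) (hK.image (by fun_prop))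
      (hc.translate _) (fun f a b hf => by
        have := hwidth f (a + f p) (b + f p) fun x hx => by
          have := hf _ ⟨x, hx, rfl⟩
          simp only [map_add, map_neg, Set.mem_Icc] at this ⊢
          constructor <;> linarith
        linarith) 0 ⟨p, hp, by simp⟩ rfl
    refine ⟨p + z, fun x hx => ?_⟩
    obtain ⟨y, hy, hyx⟩ := hz (show -p + x ∈ _ by
      rw [mem_closedBall, dist_eq_norm] at hx ⊢
      convert hx using 2
      abel)
    rwa [← add_left_cancel hyx]
  subst hp0
  have hspan : ⊤ ≤ Submodule.span ℝ K := by
    by_contra h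
    obtain ⟨f, hf0, hf⟩ := Submodule.exists_le_ker_of_lt_top _ (lt_top_iff_ne_top.2 fun h' =>
      h h'.ge)
    have := hwidth f.toContinuousLinearMap 0 0 fun x hx => by
      have : f x = 0 := hf (Submodule.subset_span hx)
      simp [this]
    have h0 : ‖f.toContinuousLinearMap‖ ≤ 0 := by nlinarith
    exact hf0 (by simpa using h0)
  generalize hn : Module.finrank ℝ E = n
  obtain ⟨v, hvK, hv⟩ := hK.exists_basis_abs_repr_le_one hspan hn
  refine ⟨∑ i, ((n : ℝ) + 1)⁻¹ • v i, fun x hx => ?_⟩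
  set u := x - ∑ i, ((n : ℝ) + 1)⁻¹ • v i with hu
  have hunorm : ‖u‖ ≤ w / (2 * (n * (n + 1))) := by simpa [dist_eq_norm] using hx
  have hcoord (i : Fin n) : |v.repr u i| ≤ ((n : ℝ) * (n + 1))⁻¹ := by
    have hn : (0 : ℝ) < n := by exact_mod_cast i.pos
    have h1 := hwidth (v.coord i).toContinuousLinearMap (-1) 1 fun y hy => abs_le.1 (hv y hy i)
    have h2 := (v.coord i).toContinuousLinearMap.le_opNorm u
    set F := ‖(v.coord i).toContinuousLinearMap‖
    have h3 : F ≤ 2 / w := by rw [le_div_iff₀ hw]; linarith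
    calc |v.repr u i| ≤ F * ‖u‖ := h2
      _ ≤ 2 / w * (w / (2 * (n * (n + 1)))) := by gcongr
      _ = _ := by field_simp
  have hx' : x = ∑ i, (((n : ℝ) + 1)⁻¹ + v.repr u i) • v i := by
    simp only [add_smul, Finset.sum_add_distrib, v.sum_repr]
    rw [hu]
    abel
  rw [hx']
  refine hc.sum_mem_of_zero_mem hp (fun i => ?_) ?_ hvK
  · have hn : (1 : ℝ) ≤ n := by exact_mod_cast i.pos
    have h1 : ((n : ℝ) * (n + 1))⁻¹ ≤ ((n : ℝ) + 1)⁻¹ := by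
      gcongr
      nlinarith
    linarith [(abs_le.1 (hcoord i)).1]
  · calc ∑ i, (((n : ℝ) + 1)⁻¹ + v.repr u i)
        ≤ ∑ _i : Fin n, (((n : ℝ) + 1)⁻¹ + ((n : ℝ) * (n + 1))⁻¹) :=
          Finset.sum_le_sum fun i _ => by gcongr; exact (abs_le.1 (hcoord i)).2
      _ ≤ 1 := by
        rw [Finset.sum_const, Finset.card_univ, Fintype.card_fin, nsmul_eq_mul]
        rcases Nat.eq_zero_or_pos n with h | h
        · simp [h]
        · have : (0 : ℝ) < n := by exact_mod_cast h
          apply le_of_eq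
          field_simp

/-- The width bounds from below the variation over `K` of a linear functional. -/
theorem bwidth_mul_norm_le {d : ℕ} {K : Set (EuclideanSpace ℝ (Fin d))} (hne : K.Nonempty)
    (hK : IsCompact K) (f : EuclideanSpace ℝ (Fin d) →L[ℝ] ℝ) (a b : ℝ)
    (hf : ∀ x ∈ K, f x ∈ Set.Icc a b) : bwidth K * ‖f‖ ≤ b - a := by
  have hab : a ≤ b := by
    obtain ⟨x, hx⟩ := hne
    exact (hf x hx).1.trans (hf x hx).2
  rcases eq_or_ne f 0 with rfl | hf0
  · simpa using hab
  have hnf : 0 < ‖f‖ := norm_pos_iff.2 hf0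
  set y := (InnerProductSpace.toDual ℝ (EuclideanSpace ℝ (Fin d))).symm f with hy
  have hyn : ‖y‖ = ‖f‖ := LinearIsometryEquiv.norm_map _ _
  have hfy (x) : ⟪x, y⟫ = f x := by
    rw [real_inner_comm, hy, InnerProductSpace.toDual_symm_apply]
  set n := ‖f‖⁻¹ • y with hn
  have hn1 : ‖n‖ = 1 := by rw [hn, norm_smul, hyn, norm_inv, norm_norm, inv_mul_cancel₀ hnf.ne']
  have hle : bwidth K ≤ suppF K n + suppF K (-n) := by
    refine csInf_le ⟨0, ?_⟩ ⟨n, hn1, rfl⟩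
    rintro _ ⟨m, -, rfl⟩
    obtain ⟨x, hx⟩ := hne
    have hbdd (m : EuclideanSpace ℝ (Fin d)) : ⟪x, m⟫ ≤ suppF K m :=
      le_csSup (hK.image (by fun_prop)).bddAbove ⟨x, hx, rfl⟩
    have h1 := hbdd m
    have h2 := hbdd (-m)
    rw [inner_neg_right] at h2
    change 0 ≤ suppF K m + suppF K (-m)
    linarith
  have h1 : suppF K n ≤ ‖f‖⁻¹ * b := by
    refine csSup_le (hne.image _) ?_
    rintro _ ⟨x, hx, rfl⟩
    simp only [hn, inner_smul_right, hfy]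
    gcongr
    exact (hf x hx).2
  have h2 : suppF K (-n) ≤ -(‖f‖⁻¹ * a) := by
    refine csSup_le (hne.image _) ?_
    rintro _ ⟨x, hx, rfl⟩
    simp only [hn, inner_neg_right, inner_smul_right, hfy, neg_le_neg_iff]
    gcongr
    exact (hf x hx).1
  calc bwidth K * ‖f‖ ≤ (‖f‖⁻¹ * b + -(‖f‖⁻¹ * a)) * ‖f‖ := by gcongr; linarith
    _ = b - a := by field_simp; ring

/-- A compact set has a finite cover by closed balls of radius `r` centred at points of the set
such that the concentric open balls of radius `r / 2` are pairwise disjoint. -/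
theorem IsCompact.exists_finset_cover_pairwiseDisjoint {E : Type*} [MetricSpace E] {K : Set E}
    (hK : IsCompact K) {r : ℝ} (hr : 0 < r) :
    ∃ s : Finset E, ↑s ⊆ K ∧ K ⊆ ⋃ x ∈ s, closedBall x r ∧
      (s : Set E).PairwiseDisjoint fun x => ball x (r / 2) := by
  lift r to NNReal using hr.le
  have hr' : r / 2 ≠ 0 := by
    have : r ≠ 0 := by rintro rfl; simp at hr
    simpa using this
  have hpack : packingNumber r K ≠ ⊤ := by
    obtain ⟨N, -, hN, hcov⟩ := exists_finite_isCover_of_isCompact hr' hK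
    have h1 := packingNumber_two_mul_le_externalCoveringNumber (r / 2) K
    rw [mul_div_cancel₀ r two_ne_zero] at h1
    exact ne_top_of_le_ne_top hN.encard_lt_top.ne
      (h1.trans hcov.externalCoveringNumber_le_encard)
  have hfin : (maximalSeparatedSet r K).Finite := by
    rw [← Set.encard_ne_top_iff, encard_maximalSeparatedSet hpack]
    exact hpack
  refine ⟨hfin.toFinset, ?_, ?_, ?_⟩
  · simpa using maximalSeparatedSet_subset
  · simpa using isCover_iff_subset_iUnion_closedBall.1 (isCover_maximalSeparatedSet hpack)
  · rw [hfin.coe_toFinset]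
    intro x hx y hy hxy
    have h : (r : ℝ≥0∞) < edist x y := isSeparated_maximalSeparatedSet hx hy hxy
    refine ball_disjoint_ball ?_
    rw [edist_nndist] at h
    have : r < nndist x y := by exact_mod_cast h
    have : (r : ℝ) < dist x y := by exact_mod_cast this
    linarith

/-- If a convex set `K` contains a ball of radius `ρ`, then a dilate of `K` by the factor `1 + t`
contains the `t * ρ`-neighbourhood of `K`. -/
theorem Convex.ball_subset_homothety_image {E : Type*} [NormedAddCommGroup E] [NormedSpace ℝ E]
    {K : Set E} (hc : Convex ℝ K) {z x : E} {ρ t : ℝ} (hz : closedBall z ρ ⊆ K) (hx : x ∈ K)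
    (ht : 0 < t) : ball x (t * ρ) ⊆ AffineMap.homothety z (1 + t) '' K := by
  intro y hy
  have hk : z + t⁻¹ • (y - x) ∈ K := by
    refine hz ?_
    rw [mem_closedBall, dist_eq_norm, add_sub_cancel_left, norm_smul, norm_inv, Real.norm_eq_abs,
      abs_of_pos ht, inv_mul_le_iff₀ ht, ← dist_eq_norm]
    exact (mem_ball.1 hy).le
  refine ⟨(1 + t)⁻¹ • x + (t * (1 + t)⁻¹) • (z + t⁻¹ • (y - x)),
    hc hx hk (by positivity) (by positivity) (by field_simp), ?_⟩
  rw [AffineMap.homothety_apply]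
  simp only [vsub_eq_sub, vadd_eq_add]
  match_scalars <;> field_simp <;> ring

/-- Covering lemma: for every `d` there is a constant `C_d > 0` such that every convex body
`K ⊆ ℝ^d` can be covered, for every `0 < r ≤ width K`, by `M` closed balls of radius `r` with
`M · r^d ≤ C_d · λ_d(K)`. -/
theorem statement2 (d : ℕ) :
    ∃ C : ℝ, 0 < C ∧
      ∀ K : Set (EuclideanSpace ℝ (Fin d)), K.Nonempty → IsCompact K → Convex ℝ K →
        ∀ r : ℝ, 0 < r → r ≤ bwidth K →
          ∃ (M : ℕ) (x : Fin M → EuclideanSpace ℝ (Fin d)),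
            K ⊆ ⋃ i, Metric.closedBall (x i) r ∧
            (M : ℝ) * r ^ d ≤ C * (volume K).toReal := by
  set t : ℝ := d * (d + 1) with ht
  set ω : ℝ := (volume (ball (0 : EuclideanSpace ℝ (Fin d)) 1)).toReal with hω
  have hω0 : 0 < ω := ENNReal.toReal_pos (measure_ball_pos _ _ one_pos).ne' measure_ball_lt_top.ne
  have ht0 : 0 ≤ t := by positivity
  refine ⟨(1 + t) ^ d * 2 ^ d / ω, by positivity, fun K hne hK hc r hr hrw => ?_⟩
  have hd : 0 < d := by
    rcases Nat.eq_zero_or_pos d with rfl | h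
    · have h0 : bwidth K = 0 := by
        have : {n : EuclideanSpace ℝ (Fin 0) | ‖n‖ = 1} = ∅ := by
          ext n
          simp [Subsingleton.elim n 0]
        rw [bwidth, this, Set.image_empty, Real.sInf_empty]
      linarith
    · exact h
  have htpos : 0 < t := by positivity
  obtain ⟨z, hz⟩ := hK.exists_closedBall_subset_of_width hne hc hr fun f a b hf =>
    (mul_le_mul_of_nonneg_right hrw (norm_nonneg f)).trans (bwidth_mul_norm_le hne hK f a b hf)
  rw [finrank_euclideanSpace_fin, ← ht] at hz
  obtain ⟨s, hsK, hcov, hdisj⟩ := hK.exists_finset_cover_pairwiseDisjoint hr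
  refine ⟨s.card, fun i => s.equivFin.symm i, fun x hx => ?_, ?_⟩
  · obtain ⟨y, hy, hxy⟩ := Set.mem_iUnion₂.1 (hcov hx)
    exact Set.mem_iUnion.2 ⟨s.equivFin ⟨y, hy⟩, by simpa using hxy⟩
  have hsub : ⋃ x ∈ s, ball x (r / 2) ⊆ AffineMap.homothety z (1 + t) '' K := by
    refine Set.iUnion₂_subset fun x hx => ?_
    have hrad : t * (r / (2 * t)) = r / 2 := by field_simp
    exact hrad ▸ hc.ball_subset_homothety_image hz (hsK hx) htpos
  have hvol := measure_mono (μ := volume) hsub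
  rw [measure_biUnion_finset hdisj fun _ _ => measurableSet_ball,
    Measure.addHaar_image_homothety, finrank_euclideanSpace_fin] at hvol
  simp only [Measure.addHaar_ball_of_pos volume _ (half_pos hr), finrank_euclideanSpace_fin,
    Finset.sum_const, nsmul_eq_mul] at hvol
  have hreal := ENNReal.toReal_mono
    (ENNReal.mul_ne_top ENNReal.ofReal_ne_top hK.measure_lt_top.ne) hvol
  rw [ENNReal.toReal_mul, ENNReal.toReal_mul, ENNReal.toReal_mul, ENNReal.toReal_natCast,
    ENNReal.toReal_ofReal (by positivity), ENNReal.toReal_ofReal (abs_nonneg _),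
    abs_of_nonneg (by positivity), ← hω] at hreal
  have hr2 : r ^ d = 2 ^ d * (r / 2) ^ d := by rw [← mul_pow, mul_div_cancel₀ r two_ne_zero]
  calc (s.card : ℝ) * r ^ d = 2 ^ d / ω * (s.card * ((r / 2) ^ d * ω)) := by
        rw [hr2]
        field_simp
    _ ≤ 2 ^ d / ω * ((1 + t) ^ d * (volume K).toReal) := by gcongr
    _ = (1 + t) ^ d * 2 ^ d / ω * (volume K).toReal := by ring
end

section
/- Let K ⊆ ℝ^d be a convex body and K̃ := K + B̄(0,1). Let ν ∈ S^{d−1} and 0 < t < 1. Then for any points x₁, x₂ ∈ C(K̃, ν, t) and any unit outer normals n₁ ∈ nor(K̃, x₁), n₂ ∈ nor(K̃, x₂), the spherical distance between n₁ and n₂ satisfies arccos(n₁·n₂) < 2√(3t). -/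
open MeasureTheory Metric Filter Set Pointwise
open scoped RealInnerProductSpace ENNReal

/-- A unit outer normal of the parallel body `K + B̄(0,1)` at `x` points from `K` to `x`. -/
lemma sub_mem_of_mem_nor_add_closedBall {d : ℕ} {K : Set (EuclideanSpace ℝ (Fin d))}
    {x n : EuclideanSpace ℝ (Fin d)} (hx : x ∈ K + Metric.closedBall 0 1)
    (hn : n ∈ nor (K + Metric.closedBall 0 1) x) : x - n ∈ K := by
  obtain ⟨k, hk, b, hb, rfl⟩ := Set.mem_add.1 hx
  obtain ⟨hn1, hn⟩ := hn
  have hb' : ‖b‖ ≤ 1 := by simpa using hb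
  have h := hn (k + n) (Set.add_mem_add hk (by simp [hn1]))
  rw [inner_add_right, inner_add_right, real_inner_self_eq_norm_sq, hn1] at h
  have h2 : ‖b - n‖ ^ 2 ≤ 0 := by
    rw [norm_sub_sq_real, real_inner_comm, hn1]
    nlinarith [norm_nonneg b]
  have h3 : b - n = 0 := by simpa using h2
  rw [add_sub_assoc, h3, add_zero]
  exact hk

/-- Unit outer normals on a cap of `K + B̄(0,1)` are close to the direction of the cap. -/
lemma one_sub_le_inner_of_mem_cap {d : ℕ} {K : Set (EuclideanSpace ℝ (Fin d))}
    (hKc : IsCompact K) {ν x n : EuclideanSpace ℝ (Fin d)} (hν : ‖ν‖ = 1) {t : ℝ}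
    (hx : x ∈ cap (K + Metric.closedBall 0 1) ν t)
    (hn : n ∈ nor (K + Metric.closedBall 0 1) x) : 1 - t ≤ ⟪n, ν⟫ := by
  obtain ⟨hx, hxt⟩ := hx
  have hmem : x - n + ν ∈ K + Metric.closedBall 0 1 :=
    Set.add_mem_add (sub_mem_of_mem_nor_add_closedBall hx hn) (by simp [hν])
  have hbdd : BddAbove ((fun y => ⟪y, ν⟫) '' (K + Metric.closedBall 0 1)) :=
    ((hKc.add (isCompact_closedBall 0 1)).image (by fun_prop)).bddAbove
  have h : ⟪x - n + ν, ν⟫ ≤ suppF (K + Metric.closedBall 0 1) ν :=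
    le_csSup hbdd (Set.mem_image_of_mem (fun y => ⟪y, ν⟫) hmem)
  rw [inner_add_left, inner_sub_left, real_inner_self_eq_norm_sq, hν] at h
  linarith

lemma Real.arccos_lt_sqrt_three_mul {c t : ℝ} (ht0 : 0 < t) (ht1 : t < 1) (hc : 1 - t ≤ c)
    (hc1 : c ≤ 1) : Real.arccos c < Real.sqrt (3 * t) := by
  set y := Real.arccos c / 2 with hy
  have hcy : Real.cos (2 * y) = c := by
    rw [hy, mul_div_cancel₀ _ two_ne_zero, Real.cos_arccos (by linarith) hc1]
  apply Real.lt_sqrt_of_sq_lt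
  have hy0 : 0 ≤ y := div_nonneg (Real.arccos_nonneg c) two_pos.le
  rcases hy0.eq_or_lt with h0 | hpos
  · nlinarith
  have hpi : Real.arccos c ≤ Real.pi / 2 := Real.arccos_le_pi_div_two.2 (by linarith)
  have hy1 : y ≤ 0.7855 := by linarith [Real.pi_lt_d4]
  have hsin := Real.sin_gt_sub_cube hpos
  have hlow : 0.84 * y ≤ Real.sin y := by
    nlinarith [mul_nonneg hy0 (by nlinarith : (0 : ℝ) ≤ 0.64 - y ^ 2)]
  have hsq : (0.84 * y) ^ 2 ≤ Real.sin y ^ 2 := pow_le_pow_left₀ (by positivity) hlow 2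
  have hcos : c = 1 - 2 * Real.sin y ^ 2 := by
    rw [← hcy, Real.cos_two_mul, Real.cos_sq']; ring
  have hθ : Real.arccos c = 2 * y := by rw [hy]; ring
  rw [hθ]
  nlinarith [pow_pos hpos 2]

/-- For a convex body `K ⊆ ℝ^d` and `K̃ = K + B̄(0,1)`, any two unit outer normals attained on the
cap `C(K̃, ν, t)` (`0 < t < 1`) are at spherical distance less than `2√(3t)`. -/
theorem statement3 {d : ℕ} (K : Set (EuclideanSpace ℝ (Fin d)))
    (hK : K.Nonempty) (hKc : IsCompact K) (hKconv : Convex ℝ K)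
    (ν : EuclideanSpace ℝ (Fin d)) (hν : ‖ν‖ = 1) (t : ℝ) (ht0 : 0 < t) (ht1 : t < 1)
    (x₁ x₂ n₁ n₂ : EuclideanSpace ℝ (Fin d))
    (hx₁ : x₁ ∈ cap (K + Metric.closedBall 0 1) ν t)
    (hx₂ : x₂ ∈ cap (K + Metric.closedBall 0 1) ν t)
    (hn₁ : n₁ ∈ nor (K + Metric.closedBall 0 1) x₁)
    (hn₂ : n₂ ∈ nor (K + Metric.closedBall 0 1) x₂) :
    Real.arccos ⟪n₁, n₂⟫ < 2 * Real.sqrt (3 * t) := by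
  have h₁ := one_sub_le_inner_of_mem_cap hKc hν hx₁ hn₁
  have h₂ := one_sub_le_inner_of_mem_cap hKc hν hx₂ hn₂
  have hangle {u v : EuclideanSpace ℝ (Fin d)} (hu : ‖u‖ = 1) (hv : ‖v‖ = 1) :
      InnerProductGeometry.angle u v = Real.arccos ⟪u, v⟫ := by
    simp [InnerProductGeometry.angle, hu, hv]
  have hle {u : EuclideanSpace ℝ (Fin d)} (hu : ‖u‖ = 1) : ⟪u, ν⟫ ≤ 1 := by
    simpa [hu, hν] using real_inner_le_norm u ν
  have htri := InnerProductGeometry.angle_le_angle_add_angle n₁ ν n₂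
  rw [InnerProductGeometry.angle_comm ν n₂, hangle hn₁.1 hn₂.1, hangle hn₁.1 hν,
    hangle hn₂.1 hν] at htri
  linarith [Real.arccos_lt_sqrt_three_mul ht0 ht1 h₁ (hle hn₁.1),
    Real.arccos_lt_sqrt_three_mul ht0 ht1 h₂ (hle hn₂.1)]
end

section
/- Let K ⊆ ℝ^d be a convex body, K̃ := K + B̄(0,1), ν ∈ S^{d−1}, and t > 0. If x ∈ C(K̃, ν, t) and n ∈ nor(K̃, x), then n·ν ≥ 1 − t. -/
open MeasureTheory Metric Filter Set Pointwise
open scoped RealInnerProductSpace ENNReal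

/-- For a convex body `K ⊆ ℝ^d`, `K̃ = K + B̄(0,1)`, `ν ∈ S^{d-1}` and `t > 0`: if
`x ∈ C(K̃, ν, t)` and `n ∈ nor(K̃, x)`, then `n · ν ≥ 1 - t`. -/
theorem statement4 {d : ℕ} (K : Set (EuclideanSpace ℝ (Fin d)))
    (hK : K.Nonempty) (hKc : IsCompact K) (hKconv : Convex ℝ K)
    (ν : EuclideanSpace ℝ (Fin d)) (hν : ‖ν‖ = 1) (t : ℝ) (ht : 0 < t)
    (x n : EuclideanSpace ℝ (Fin d))
    (hx : x ∈ cap (K + Metric.closedBall 0 1) ν t)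
    (hn : n ∈ nor (K + Metric.closedBall 0 1) x) :
    1 - t ≤ ⟪n, ν⟫ := by
  obtain ⟨hxmem, hcap⟩ := hx
  obtain ⟨hn1, hmax⟩ := hn
  obtain ⟨k, hk, b, hb, rfl⟩ := Set.mem_add.mp hxmem
  have hb1 : ‖b‖ ≤ 1 := mem_closedBall_zero_iff.mp hb
  have hbn : b = n := by
    have h := hmax (k + n) (Set.add_mem_add hk (mem_closedBall_zero_iff.mpr hn1.le))
    rw [inner_add_right, inner_add_right, real_inner_self_eq_norm_sq, hn1] at h
    have hsq := norm_sub_sq_real n b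
    rw [hn1] at hsq
    have hzero : ‖n - b‖ = 0 := by nlinarith [norm_nonneg b, sq_nonneg ‖n - b‖]
    exact (sub_eq_zero.mp (norm_eq_zero.mp hzero)).symm
  subst hbn
  have hbdd : BddAbove ((fun y => ⟪y, ν⟫) '' (K + Metric.closedBall 0 1)) :=
    ((hKc.add (isCompact_closedBall 0 1)).image (by fun_prop)).bddAbove
  have hsupp : ⟪k + ν, ν⟫ ≤ suppF (K + Metric.closedBall 0 1) ν :=
    le_csSup hbdd ⟨k + ν, Set.add_mem_add hk (mem_closedBall_zero_iff.mpr hν.le), rfl⟩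
  rw [inner_add_left, real_inner_self_eq_norm_sq, hν] at hsupp
  rw [inner_add_left] at hcap
  linarith
end

section
/- Let g, h : ℝ^d → ℝ be convex functions and let K ⊆ ℝ^d be compact. Then the set E_K(g,h) := {(x, u − v) : x ∈ K, u ∈ ∂g(x), v ∈ ∂h(x)} ⊆ ℝ^d × ℝ^d = ℝ^{2d} has finite d-dimensional upper Minkowski content. -/
open MeasureTheory Metric Filter Set Pointwise
open scoped RealInnerProductSpace ENNReal

/-- The subdifferential of a function `g : ℝ^d → ℝ` at `x`. -/
def subdiff {d : ℕ} (g : EuclideanSpace ℝ (Fin d) → ℝ) (x : EuclideanSpace ℝ (Fin d)) :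
    Set (EuclideanSpace ℝ (Fin d)) :=
  {u | ∀ y, g x + ⟪u, y - x⟫ ≤ g y}


/-- The Bregman gap at `y` of `g` with respect to its affine minorant of slope `u` at `x`. -/
noncomputable def bregman {d : ℕ} (g : EuclideanSpace ℝ (Fin d) → ℝ)
    (x u y : EuclideanSpace ℝ (Fin d)) : ℝ :=
  g y - g x - ⟪u, y - x⟫

theorem bregman_nonneg {d : ℕ} {g : EuclideanSpace ℝ (Fin d) → ℝ}
    {x u : EuclideanSpace ℝ (Fin d)} (hu : u ∈ subdiff g x) (y : EuclideanSpace ℝ (Fin d)) :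
    0 ≤ bregman g x u y := by
  have := hu y
  unfold bregman
  linarith

theorem bregman_three_point {d : ℕ} (g : EuclideanSpace ℝ (Fin d) → ℝ)
    (x u x' u' y : EuclideanSpace ℝ (Fin d)) :
    bregman g x' u' y = bregman g x u y + bregman g x' u' x + ⟪u - u', y - x⟫ := by
  simp only [bregman, inner_sub_left, inner_sub_right]
  ring

/-- The Bregman gap of `g + h + ‖·‖²` at `y`, for the slope `u + v + 2 • x` at `x`. -/
noncomputable def gap {d : ℕ} (g h : EuclideanSpace ℝ (Fin d) → ℝ)
    (x u v y : EuclideanSpace ℝ (Fin d)) : ℝ :=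
  bregman g x u y + bregman h x v y + ‖y - x‖ ^ 2

theorem gap_three_point {d : ℕ} (g h : EuclideanSpace ℝ (Fin d) → ℝ)
    (x u v x' u' v' y : EuclideanSpace ℝ (Fin d)) :
    gap g h x' u' v' y = gap g h x u v y + gap g h x' u' v' x +
      ⟪(u + v + (2 : ℝ) • x) - (u' + v' + (2 : ℝ) • x'), y - x⟫ := by
  have hn : ‖y - x'‖ ^ 2 = ‖y - x‖ ^ 2 + 2 * ⟪y - x, x - x'⟫ + ‖x - x'‖ ^ 2 := by
    rw [← norm_add_sq_real, sub_add_sub_cancel]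
  have hi : ⟪(u + v + (2 : ℝ) • x) - (u' + v' + (2 : ℝ) • x'), y - x⟫ =
      ⟪u - u', y - x⟫ + ⟪v - v', y - x⟫ + 2 * ⟪y - x, x - x'⟫ := by
    rw [real_inner_comm (x - x') (y - x)]
    simp only [inner_sub_left, inner_add_left, inner_smul_left, RCLike.conj_to_real]
    ring
  rw [gap, gap, gap, bregman_three_point g x u x' u' y, bregman_three_point h x v x' v' y, hn, hi]
  ring

theorem sq_norm_le_gap {d : ℕ} {g h : EuclideanSpace ℝ (Fin d) → ℝ}
    {x u v : EuclideanSpace ℝ (Fin d)} (hu : u ∈ subdiff g x) (hv : v ∈ subdiff h x)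
    (y : EuclideanSpace ℝ (Fin d)) : ‖y - x‖ ^ 2 ≤ gap g h x u v y := by
  have := bregman_nonneg hu y
  have := bregman_nonneg hv y
  unfold gap
  linarith

/-- The `s`-dilate of the symmetrised dual cap of `g + h + ‖·‖²` of height `t` at `x`. -/
def dualCap {d : ℕ} (g h : EuclideanSpace ℝ (Fin d) → ℝ) (t s : ℝ)
    (x u v : EuclideanSpace ℝ (Fin d)) : Set (EuclideanSpace ℝ (Fin d)) :=
  {w | ∀ y, |⟪w, y - x⟫| ≤ s * (gap g h x u v y + t)}

theorem isClosed_dualCap {d : ℕ} (g h : EuclideanSpace ℝ (Fin d) → ℝ) (t s : ℝ)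
    (x u v : EuclideanSpace ℝ (Fin d)) : IsClosed (dualCap g h t s x u v) := by
  simp only [dualCap, ofPred_forall]
  exact isClosed_iInter fun y => isClosed_le (by fun_prop) continuous_const

theorem dualCap_eq_smul {d : ℕ} (g h : EuclideanSpace ℝ (Fin d) → ℝ) {t r : ℝ} (hr : 0 < r)
    (s : ℝ) (x u v : EuclideanSpace ℝ (Fin d)) :
    dualCap g h t (r * s) x u v = r • dualCap g h t s x u v := by
  ext w
  rw [mem_smul_set_iff_inv_smul_mem₀ hr.ne']
  simp only [dualCap, mem_ofPred_eq, inner_smul_left, abs_mul, RCLike.conj_to_real,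
    abs_of_pos (inv_pos.2 hr), inv_mul_le_iff₀ hr, mul_assoc]

theorem closedBall_subset_dualCap {d : ℕ} {g h : EuclideanSpace ℝ (Fin d) → ℝ} {ε s : ℝ}
    (hs : 0 ≤ s) {x u v : EuclideanSpace ℝ (Fin d)} (hu : u ∈ subdiff g x)
    (hv : v ∈ subdiff h x) :
    closedBall 0 (2 * s * ε) ⊆ dualCap g h (ε ^ 2) s x u v := by
  intro w hw y
  rw [mem_closedBall_zero_iff] at hw
  have h1 := abs_real_inner_le_norm w (y - x)
  have h2 := sq_norm_le_gap hu hv y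
  have h3 := mul_le_mul_of_nonneg_right hw (norm_nonneg (y - x))
  have h4 := mul_le_mul_of_nonneg_left h2 hs
  nlinarith [mul_nonneg hs (sq_nonneg (ε - ‖y - x‖))]

/-- Two intersecting half dual caps are comparable: the base points are close, and the slope
differences `u - v` agree up to a dilate of the first dual cap. -/
theorem comparable_of_dualCap_inter {d : ℕ} {g h : EuclideanSpace ℝ (Fin d) → ℝ} {t : ℝ}
    {x u v x' u' v' w w' : EuclideanSpace ℝ (Fin d)}
    (hu : u ∈ subdiff g x) (hv : v ∈ subdiff h x)
    (hu' : u' ∈ subdiff g x') (hv' : v' ∈ subdiff h x')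
    (hw : w ∈ dualCap g h t (1 / 2) x u v) (hw' : w' ∈ dualCap g h t (1 / 2) x' u' v')
    (heq : u + v + (2 : ℝ) • x + w = u' + v' + (2 : ℝ) • x' + w') :
    ‖x' - x‖ ^ 2 ≤ t ∧ (u' - v') - (u - v) ∈ dualCap g h t 12 x u v := by
  have hp : (u + v + (2 : ℝ) • x) - (u' + v' + (2 : ℝ) • x') = w' - w :=
    sub_eq_sub_iff_add_eq_add.2 (by rw [heq]; abel)
  have three (y) : gap g h x' u' v' y =
      gap g h x u v y + gap g h x' u' v' x + (⟪w', y - x⟫ - ⟪w, y - x⟫) := by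
    rw [gap_three_point g h x u v, hp, inner_sub_left]
  have h0 : gap g h x' u' v' x' = 0 := by simp [gap, bregman]
  have hx := three x'
  have w1 := abs_le.1 (hw x')
  have w2 := abs_le.1 (hw' x)
  have e1 (a y : EuclideanSpace ℝ (Fin d)) : ⟪a, y - x⟫ = ⟪a, y - x'⟫ - ⟪a, x - x'⟫ := by
    simp only [inner_sub_right]; ring
  have e2 := e1 w' x'
  simp only [sub_self, inner_zero_right] at e2
  have q1 := sq_norm_le_gap hu hv x'
  have q2 := sq_norm_le_gap hu' hv' x
  have hsum : gap g h x u v x' + gap g h x' u' v' x ≤ 2 * t := by linarith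
  rw [norm_sub_rev] at q2
  refine ⟨by linarith, fun y => ?_⟩
  have a1 := abs_le.1 (hw y)
  have a2 := abs_le.1 (hw' y)
  have a3 := e1 w' y
  have b := three y
  have bg := bregman_three_point g x u x' u' y
  have bh := bregman_three_point h x v x' v' y
  have g1 := bregman_nonneg hu y
  have g2 := bregman_nonneg hu' y
  have g3 := bregman_nonneg hu' x
  have k1 := bregman_nonneg hv y
  have k2 := bregman_nonneg hv' y
  have k3 := bregman_nonneg hv' x
  have p1 : ⟪u - u', y - x⟫ + ⟪v - v', y - x⟫ + 2 * ⟪x - x', y - x⟫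
      = ⟪w', y - x⟫ - ⟪w, y - x⟫ := by
    rw [← inner_sub_left w' w, ← hp]
    simp only [inner_sub_left, inner_add_left, inner_smul_left, RCLike.conj_to_real]
    ring
  have p2 : ⟪(u' - v') - (u - v), y - x⟫ = ⟪v - v', y - x⟫ - ⟪u - u', y - x⟫ := by
    simp only [inner_sub_left]; ring
  have c1 := abs_le.1 (abs_real_inner_le_norm (x - x') (y - x))
  rw [norm_sub_rev x x'] at c1
  have c2 := sq_nonneg (‖x' - x‖ - ‖y - x‖)
  have n4 := sq_nonneg ‖y - x'‖
  rw [p2, abs_le]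
  simp only [gap] at *
  constructor <;> linarith

theorem norm_le_of_mem_subdiff {d : ℕ} {g : EuclideanSpace ℝ (Fin d) → ℝ} {M : ℝ}
    {x u : EuclideanSpace ℝ (Fin d)} (hM : ∀ y ∈ closedBall x 1, |g y| ≤ M)
    (hu : u ∈ subdiff g x) : ‖u‖ ≤ 2 * M := by
  have hx := abs_le.1 (hM x (by simp))
  rcases eq_or_ne u 0 with rfl | hne
  · rw [norm_zero]; linarith
  have hn : ‖u‖ ≠ 0 := norm_ne_zero_iff.2 hne
  have hy := abs_le.1 (hM (x + ‖u‖⁻¹ • u) (by simp [norm_smul, hn]))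
  have := hu (x + ‖u‖⁻¹ • u)
  rw [add_sub_cancel_left, inner_smul_right, real_inner_self_eq_norm_sq, pow_two,
    inv_mul_cancel_left₀ hn] at this
  linarith

theorem norm_le_of_mem_dualCap {d : ℕ} {g h : EuclideanSpace ℝ (Fin d) → ℝ} {M t : ℝ}
    {x u v w : EuclideanSpace ℝ (Fin d)} (hgM : ∀ y ∈ closedBall x 1, |g y| ≤ M)
    (hhM : ∀ y ∈ closedBall x 1, |h y| ≤ M) (hu : u ∈ subdiff g x) (hv : v ∈ subdiff h x)
    (ht : t ≤ 1) (hw : w ∈ dualCap g h t (1 / 2) x u v) : ‖w‖ ≤ 4 * M + 1 := by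
  have hx := abs_le.1 (hgM x (by simp))
  have hx' := abs_le.1 (hhM x (by simp))
  rcases eq_or_ne w 0 with rfl | hne
  · rw [norm_zero]; linarith
  have hn : ‖w‖ ≠ 0 := norm_ne_zero_iff.2 hne
  have hz : ‖‖w‖⁻¹ • w‖ = 1 := by simp [norm_smul, hn]
  have hmem : x + ‖w‖⁻¹ • w ∈ closedBall x 1 := by simp [norm_smul, hn]
  have hy := abs_le.1 (hgM _ hmem)
  have hy' := abs_le.1 (hhM _ hmem)
  have hUu := norm_le_of_mem_subdiff hgM hu
  have hVv := norm_le_of_mem_subdiff hhM hv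
  have i1 := abs_le.1 (abs_real_inner_le_norm u (‖w‖⁻¹ • w))
  have i2 := abs_le.1 (abs_real_inner_le_norm v (‖w‖⁻¹ • w))
  rw [hz, mul_one] at i1 i2
  have := (abs_le.1 (hw (x + ‖w‖⁻¹ • w))).2
  simp only [gap, bregman, add_sub_cancel_left, hz] at this
  have e : ⟪w, ‖w‖⁻¹ • w⟫ = ‖w‖ := by
    rw [inner_smul_right, real_inner_self_eq_norm_sq, pow_two, inv_mul_cancel_left₀ hn]
  rw [e] at this
  linarith

/-- The splitting `ℝ^(m+n) → ℝ^m × ℝ^n` inverse to `appendE`. -/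
noncomputable def splitE {m n : ℕ} (q : EuclideanSpace ℝ (Fin (m + n))) :
    EuclideanSpace ℝ (Fin m) × EuclideanSpace ℝ (Fin n) :=
  (WithLp.toLp 2 fun i => q (Fin.castAdd n i), WithLp.toLp 2 fun i => q (Fin.natAdd m i))

theorem splitE_appendE {m n : ℕ} (x : EuclideanSpace ℝ (Fin m)) (y : EuclideanSpace ℝ (Fin n)) :
    splitE (appendE x y) = (x, y) := by
  ext i <;> simp [splitE, appendE]

theorem dist_splitE_le {m n : ℕ} (q r : EuclideanSpace ℝ (Fin (m + n))) :
    dist (splitE q) (splitE r) ≤ dist q r := by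
  rw [Prod.dist_eq, EuclideanSpace.dist_eq, EuclideanSpace.dist_eq, EuclideanSpace.dist_eq,
    Fin.sum_univ_add]
  refine max_le (Real.sqrt_le_sqrt ?_) (Real.sqrt_le_sqrt ?_)
  · exact le_add_of_nonneg_right (Finset.sum_nonneg fun _ _ => sq_nonneg _)
  · exact le_add_of_nonneg_left (Finset.sum_nonneg fun _ _ => sq_nonneg _)

theorem measurePreserving_splitE {m n : ℕ} :
    MeasurePreserving (splitE (m := m) (n := n)) := by
  have h1 := PiLp.volume_preserving_ofLp (Fin (m + n))
  have h2 := (volume_measurePreserving_piCongrLeft (fun _ : Fin (m + n) => ℝ)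
    finSumFinEquiv).symm
  have h3 := volume_measurePreserving_sumPiEquivProdPi (fun _ : Fin m ⊕ Fin n => ℝ)
  have h4 := (PiLp.volume_preserving_toLp (Fin m)).prod (PiLp.volume_preserving_toLp (Fin n))
  exact h4.comp (h3.comp (h2.comp h1))

theorem dualCap_add_mem {d : ℕ} {g h : EuclideanSpace ℝ (Fin d) → ℝ} {t s s' : ℝ}
    {x u v w w' : EuclideanSpace ℝ (Fin d)} (hw : w ∈ dualCap g h t s x u v)
    (hw' : w' ∈ dualCap g h t s' x u v) : w + w' ∈ dualCap g h t (s + s') x u v := by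
  intro y
  rw [inner_add_left, add_mul]
  exact (abs_add_le _ _).trans (add_le_add (hw y) (hw' y))

/-- The quantitative form of the statement: the `ε`-neighbourhood of the set of all
`(x, u - v)` has volume `O(ε ^ d)`. -/
theorem exists_volume_cthickening_le {d : ℕ} {g h : EuclideanSpace ℝ (Fin d) → ℝ}
    (hg : ConvexOn ℝ univ g) (hh : ConvexOn ℝ univ h)
    {K : Set (EuclideanSpace ℝ (Fin d))} (hK : IsCompact K) :
    ∃ C : ℝ≥0∞, C < ⊤ ∧ ∀ ε : ℝ, 0 < ε → ε ≤ 1 →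
      volume (cthickening ε {q : EuclideanSpace ℝ (Fin (d + d)) |
        ∃ x ∈ K, ∃ u ∈ subdiff g x, ∃ v ∈ subdiff h x, q = appendE x (u - v)}) ≤
      ENNReal.ofReal (ε ^ d) * C := by
  obtain ⟨M, hgM, hhM⟩ : ∃ M, (∀ x ∈ K, ∀ y ∈ closedBall x 1, |g y| ≤ M) ∧
      ∀ x ∈ K, ∀ y ∈ closedBall x 1, |h y| ≤ M := by
    have hc := hK.cthickening (r := 1)
    obtain ⟨M₁, h₁⟩ := hc.exists_bound_of_continuousOn hg.locallyLipschitz.continuous.continuousOn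
    obtain ⟨M₂, h₂⟩ := hc.exists_bound_of_continuousOn hh.locallyLipschitz.continuous.continuousOn
    exact ⟨max M₁ M₂,
      fun x hx y hy => (h₁ y (closedBall_subset_cthickening hx 1 hy)).trans (le_max_left _ _),
      fun x hx y hy => (h₂ y (closedBall_subset_cthickening hx 1 hy)).trans (le_max_right _ _)⟩
  obtain ⟨N, hN⟩ : ∃ N, ∀ x ∈ K, ‖x‖ ≤ N := hK.isBounded.exists_norm_le
  set R : ℝ := 2 * M + 2 * M + 2 * N + (4 * M + 1)
  refine ⟨ENNReal.ofReal (3 ^ d) * volume (closedBall (0 : EuclideanSpace ℝ (Fin d)) 1) *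
    (ENNReal.ofReal (26 ^ d) * volume (closedBall (0 : EuclideanSpace ℝ (Fin d)) R)), ?_,
    fun ε hε hε1 => ?_⟩
  · exact ENNReal.mul_lt_top
      (ENNReal.mul_lt_top ENNReal.ofReal_lt_top measure_closedBall_lt_top)
      (ENNReal.mul_lt_top ENNReal.ofReal_lt_top measure_closedBall_lt_top)
  let E := EuclideanSpace ℝ (Fin d)
  let T : Set (E × E × E) := {τ | τ.1 ∈ K ∧ τ.2.1 ∈ subdiff g τ.1 ∧ τ.2.2 ∈ subdiff h τ.1}
  let W (s : ℝ) (τ : E × E × E) : Set E := dualCap g h (ε ^ 2) s τ.1 τ.2.1 τ.2.2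
  let B (τ : E × E × E) : Set E := (τ.2.1 + τ.2.2 + (2 : ℝ) • τ.1) +ᵥ W (1 / 2) τ
  have hball : ∀ τ ∈ T, closedBall (0 : E) ε ⊆ W (1 / 2) τ := fun τ hτ => by
    simpa using closedBall_subset_dualCap (ε := ε) (s := 1 / 2) (by norm_num) hτ.2.1 hτ.2.2
  have hBne : ∀ τ ∈ T, (interior (B τ)).Nonempty := fun τ hτ => by
    rw [interior_vadd]
    exact ((nonempty_ball.2 hε).mono
      (interior_maximal (ball_subset_closedBall.trans (hball τ hτ)) isOpen_ball)).vadd_set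
  have hBR : ∀ τ ∈ T, B τ ⊆ closedBall 0 R := by
    rintro τ hτ _ ⟨w, hw, rfl⟩
    have hw' := norm_le_of_mem_dualCap (hgM _ hτ.1) (hhM _ hτ.1) hτ.2.1 hτ.2.2
      (pow_le_one₀ hε.le hε1) hw
    have hu := norm_le_of_mem_subdiff (hgM _ hτ.1) hτ.2.1
    have hv := norm_le_of_mem_subdiff (hhM _ hτ.1) hτ.2.2
    have hx : ‖(2 : ℝ) • τ.1‖ ≤ 2 * N := by
      rw [norm_smul, Real.norm_two]
      exact mul_le_mul_of_nonneg_left (hN _ hτ.1) zero_le_two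
    rw [mem_closedBall_zero_iff]
    exact norm_add_le_of_le (norm_add_le_of_le (norm_add_le_of_le hu hv) hx) hw'
  obtain ⟨I, hIT, hId, hI⟩ := Vitali.exists_disjoint_subfamily_covering_enlargement B T
    (fun _ => 1) 2 one_lt_two (fun _ _ => zero_le_one) 1 (fun _ _ => le_rfl)
    fun τ hτ => (hBne τ hτ).mono interior_subset
  have hIc : I.Countable := hId.countable_of_nonempty_interior fun τ hτ => hBne τ (hIT hτ)
  have hmeas (s : ℝ) (τ : E × E × E) : MeasurableSet (W s τ) :=
    (isClosed_dualCap _ _ _ _ _ _ _).measurableSet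
  have hcover : cthickening ε {q : EuclideanSpace ℝ (Fin (d + d)) |
        ∃ x ∈ K, ∃ u ∈ subdiff g x, ∃ v ∈ subdiff h x, q = appendE x (u - v)} ⊆
      ⋃ τ ∈ I, splitE ⁻¹' (closedBall τ.1 (3 * ε) ×ˢ ((τ.2.1 - τ.2.2) +ᵥ W 13 τ)) := by
    intro q hq
    obtain ⟨_, ⟨x, hx, u, hu, v, hv, rfl⟩, hqd⟩ := mem_thickening_iff.1
      (cthickening_subset_thickening' (by positivity) (by linarith : ε < 2 * ε) _ hq)
    obtain ⟨τ, hτ, ⟨_, ⟨w', hw', rfl⟩, ⟨w, hw, heq⟩⟩, -⟩ := hI (x, u, v) ⟨hx, hu, hv⟩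
    obtain ⟨hτK, hτu, hτv⟩ := hIT hτ
    obtain ⟨hxx, hqq⟩ := comparable_of_dualCap_inter hτu hτv hu hv hw hw' heq
    have hqd := (dist_splitE_le q (appendE x (u - v))).trans hqd.le
    rw [splitE_appendE, Prod.dist_eq, max_le_iff] at hqd
    refine mem_biUnion hτ ⟨?_, ?_⟩
    · have := abs_le_of_sq_le_sq hxx hε.le
      rw [abs_norm, ← dist_eq_norm] at this
      rw [mem_closedBall]
      linarith [dist_triangle (splitE q).1 x τ.1, hqd.1]
    · rw [mem_vadd_set_iff_neg_vadd_mem, vadd_eq_add]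
      have h1 : (splitE q).2 - (u - v) ∈ W 1 τ :=
        closedBall_subset_dualCap zero_le_one hτu hτv (by
          rw [mem_closedBall_zero_iff, ← dist_eq_norm]; linarith [hqd.2])
      have h2 := dualCap_add_mem hqq h1
      rw [show (12 : ℝ) + 1 = 13 by norm_num] at h2
      convert h2 using 1
      abel
  have hvol (τ : E × E × E) :
      volume (splitE ⁻¹' (closedBall τ.1 (3 * ε) ×ˢ ((τ.2.1 - τ.2.2) +ᵥ W 13 τ))) =
      ENNReal.ofReal (ε ^ d) * (ENNReal.ofReal (3 ^ d) * volume (closedBall (0 : E) 1) *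
        ENNReal.ofReal (26 ^ d)) * volume (B τ) := by
    rw [measurePreserving_splitE.measure_preimage
      (measurableSet_closedBall.prod ((hmeas 13 τ).const_vadd _)).nullMeasurableSet,
      Measure.volume_eq_prod, Measure.prod_prod, Measure.addHaar_closedBall' _ _ (by positivity),
      measure_vadd, measure_vadd, show (13 : ℝ) = 26 * (1 / 2) by norm_num]
    simp only [W]
    rw [dualCap_eq_smul _ _ (by norm_num : (0 : ℝ) < 26), Measure.addHaar_smul,
      finrank_euclideanSpace_fin, mul_pow, ENNReal.ofReal_mul (by positivity),
      abs_of_pos (by positivity)]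
    ring
  calc _ ≤ ∑' τ : I, volume (splitE ⁻¹' (closedBall τ.1.1 (3 * ε) ×ˢ
          ((τ.1.2.1 - τ.1.2.2) +ᵥ W 13 τ.1))) :=
        (measure_mono hcover).trans (measure_biUnion_le _ hIc _)
    _ = ENNReal.ofReal (ε ^ d) * (ENNReal.ofReal (3 ^ d) * volume (closedBall (0 : E) 1) *
        ENNReal.ofReal (26 ^ d)) * volume (⋃ τ ∈ I, B τ) := by
      rw [measure_biUnion hIc hId fun τ _ => (hmeas _ τ).const_vadd _, ← ENNReal.tsum_mul_left]
      exact tsum_congr fun τ => hvol τ.1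
    _ ≤ ENNReal.ofReal (ε ^ d) * (ENNReal.ofReal (3 ^ d) * volume (closedBall (0 : E) 1) *
        ENNReal.ofReal (26 ^ d)) * volume (closedBall (0 : E) R) := by
      gcongr
      exact iUnion₂_subset fun τ hτ => hBR τ (hIT hτ)
    _ = _ := by ring

/-- For convex `g, h : ℝ^d → ℝ` and compact `K ⊆ ℝ^d`, the set
`E_K(g,h) = {(x, u - v) : x ∈ K, u ∈ ∂g(x), v ∈ ∂h(x)}`, viewed in `ℝ^{2d}`, has finite
`d`-dimensional upper Minkowski content. -/
theorem statement5 {d : ℕ} (g h : EuclideanSpace ℝ (Fin d) → ℝ)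
    (hg : ConvexOn ℝ Set.univ g) (hh : ConvexOn ℝ Set.univ h)
    (K : Set (EuclideanSpace ℝ (Fin d))) (hK : IsCompact K) :
    minkContent (d : ℝ)
      {q : EuclideanSpace ℝ (Fin (d + d)) |
        ∃ x ∈ K, ∃ u ∈ subdiff g x, ∃ v ∈ subdiff h x, q = appendE x (u - v)} < ⊤ := by
  obtain ⟨C, hC, hle⟩ := exists_volume_cthickening_le hg hh hK
  refine lt_of_le_of_lt (limsup_le_of_le (by isBoundedDefault) ?_)
    (ENNReal.mul_lt_top (ENNReal.ofReal_lt_top (r := 2 ^ (-(d : ℝ)))) hC)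
  filter_upwards [Ioc_mem_nhdsGT zero_lt_one] with ε hε
  refine (mul_le_mul_right (hle ε hε.1 hε.2) _).trans_eq ?_
  rw [← mul_assoc, ← ENNReal.ofReal_mul (Real.rpow_nonneg (by linarith [hε.1]) _)]
  congr 2
  rw [Nat.cast_add, sub_add_cancel_left, Real.mul_rpow zero_le_two hε.1.le, mul_assoc,
    Real.rpow_neg hε.1.le, Real.rpow_natCast, inv_mul_cancel₀ (pow_pos hε.1 d).ne', mul_one]
end

section
/- Let L ⊆ ℝ^d be a convex body, K := L + B̄(0,1), n ∈ S^{d−1}, 0 < s < 1, and let H := {x ∈ ℝ^d : x·n = h_K(n) − s}. Then the orthogonal projection of the cap C(K,n,s) onto the affine hyperplane H equals K ∩ H, and moreover K ∩ H = C(K,n,s) ∩ H. -/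
open MeasureTheory Metric Filter Set Pointwise
open scoped RealInnerProductSpace ENNReal

theorem inner_le_suppF {d : ℕ} {K : Set (EuclideanSpace ℝ (Fin d))} (hK : IsCompact K)
    (n : EuclideanSpace ℝ (Fin d)) {x : EuclideanSpace ℝ (Fin d)} (hx : x ∈ K) :
    ⟪x, n⟫ ≤ suppF K n :=
  le_csSup (hK.image (by fun_prop)).bddAbove (mem_image_of_mem _ hx)

/-- Moving a point of a cap of width at most `1` of `L + B̄(0,1)` down to the base hyperplane of the
cap keeps it in the body. -/
theorem sub_smul_mem_add_closedBall {d : ℕ} {L : Set (EuclideanSpace ℝ (Fin d))}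
    (hL : IsCompact L) {n : EuclideanSpace ℝ (Fin d)} (hn : ‖n‖ = 1) {s : ℝ} (hs : s ≤ 1)
    {x : EuclideanSpace ℝ (Fin d)} (hx : x ∈ cap (L + Metric.closedBall 0 1) n s) :
    x - (⟪x, n⟫ - (suppF (L + Metric.closedBall 0 1) n - s)) • n
      ∈ L + Metric.closedBall 0 1 := by
  obtain ⟨⟨l, hl, b, hb, rfl⟩, hcap⟩ := hx
  have hln := inner_le_suppF (hL.add (isCompact_closedBall 0 1)) n
    (add_mem_add hl (mem_closedBall_zero_iff.2 hn.le))
  simp only [inner_add_left, real_inner_self_eq_norm_sq, hn] at hcap hln ⊢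
  set t := ⟪l, n⟫ + ⟪b, n⟫ - (suppF (L + Metric.closedBall 0 1) n - s) with ht
  rw [mem_closedBall_zero_iff] at hb
  refine ⟨l, hl, b - t • n, ?_, by simp only [add_sub_assoc]⟩
  have hsq : ‖b - t • n‖ ^ 2 = ‖b‖ ^ 2 - 2 * t * (⟪b, n⟫ - t) - t ^ 2 := by
    rw [norm_sub_sq_real, inner_smul_right, norm_smul, hn, mul_one, Real.norm_eq_abs, sq_abs]
    ring
  rw [mem_closedBall_zero_iff]
  have hmul : 0 ≤ t * (⟪b, n⟫ - t) := mul_nonneg (by linarith) (by linarith)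
  refine (abs_le_of_sq_le_sq' ?_ (norm_nonneg b)).2.trans hb
  nlinarith [sq_nonneg t]

/-- For a convex body `L ⊆ ℝ^d`, `K = L + B̄(0,1)`, `n ∈ S^{d-1}`, `0 < s < 1` and
`H = {x : x·n = h_K(n) - s}`: the orthogonal projection of the cap `C(K,n,s)` onto `H` equals
`K ∩ H`, and `K ∩ H = C(K,n,s) ∩ H`. -/
theorem statement12 {d : ℕ} (L : Set (EuclideanSpace ℝ (Fin d)))
    (hL : L.Nonempty) (hLc : IsCompact L) (hLconv : Convex ℝ L)
    (n : EuclideanSpace ℝ (Fin d)) (hn : ‖n‖ = 1) (s : ℝ) (hs0 : 0 < s) (hs1 : s < 1) :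
    (fun x => x - (⟪x, n⟫ - (suppF (L + Metric.closedBall 0 1) n - s)) • n) ''
        cap (L + Metric.closedBall 0 1) n s
      = (L + Metric.closedBall 0 1) ∩
          {x | ⟪x, n⟫ = suppF (L + Metric.closedBall 0 1) n - s} ∧
    (L + Metric.closedBall 0 1) ∩ {x | ⟪x, n⟫ = suppF (L + Metric.closedBall 0 1) n - s}
      = cap (L + Metric.closedBall 0 1) n s ∩
          {x | ⟪x, n⟫ = suppF (L + Metric.closedBall 0 1) n - s} := by
  have hcap : (L + Metric.closedBall 0 1) ∩
      {x | ⟪x, n⟫ = suppF (L + Metric.closedBall 0 1) n - s}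
      = cap (L + Metric.closedBall 0 1) n s ∩
          {x | ⟪x, n⟫ = suppF (L + Metric.closedBall 0 1) n - s} :=
    Set.ext fun x => ⟨fun h => ⟨⟨h.1, h.2.ge⟩, h.2⟩, fun h => ⟨h.1.1, h.2⟩⟩
  refine ⟨Subset.antisymm ?_ fun x hx => ?_, hcap⟩
  · rintro _ ⟨x, hx, rfl⟩
    refine ⟨sub_smul_mem_add_closedBall hLc hn hs1.le hx, ?_⟩
    simp [inner_sub_left, inner_smul_left, hn]
  · refine ⟨x, (hcap ▸ hx).1, ?_⟩
    have hxn : ⟪x, n⟫ = suppF (L + Metric.closedBall 0 1) n - s := hx.2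
    simp [hxn]
end

section
/- Let L ⊆ ℝ^d be a convex body, K := L + B̄(0,1), n ∈ S^{d−1}, and 0 < t ≤ 1. Then the slice {x ∈ K : x·n = h_K(n) − t} contains a (d−1)-dimensional closed ball of radius √t; that is, there exists a point c with c·n = h_K(n) − t such that every x satisfying x·n = h_K(n) − t and |x − c| ≤ √t belongs to K. -/
open MeasureTheory Metric Filter Set Pointwise
open scoped RealInnerProductSpace ENNReal

/-- For a convex body `L ⊆ ℝ^d`, `K = L + B̄(0,1)`, `n ∈ S^{d-1}` and `0 < t ≤ 1`: the slice
`{x ∈ K : x·n = h_K(n) - t}` contains a `(d-1)`-dimensional closed ball of radius `√t`. -/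
theorem statement13 {d : ℕ} (L : Set (EuclideanSpace ℝ (Fin d)))
    (hL : L.Nonempty) (hLc : IsCompact L) (hLconv : Convex ℝ L)
    (n : EuclideanSpace ℝ (Fin d)) (hn : ‖n‖ = 1) (t : ℝ) (ht0 : 0 < t) (ht1 : t ≤ 1) :
    ∃ c : EuclideanSpace ℝ (Fin d),
      ⟪c, n⟫ = suppF (L + Metric.closedBall 0 1) n - t ∧
      ∀ x : EuclideanSpace ℝ (Fin d),
        ⟪x, n⟫ = suppF (L + Metric.closedBall 0 1) n - t → ‖x - c‖ ≤ Real.sqrt t →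
          x ∈ L + Metric.closedBall 0 1 := by
  obtain ⟨y, hyL, hy⟩ := hLc.exists_isMaxOn hL
    (f := fun x => ⟪x, n⟫) (by fun_prop)
  have hnn : ⟪n, n⟫ = 1 := by rw [real_inner_self_eq_norm_sq, hn]; norm_num
  have hsupp : suppF (L + Metric.closedBall 0 1) n = ⟪y, n⟫ + 1 := by
    refine IsGreatest.csSup_eq ⟨⟨y + n, Set.add_mem_add hyL (by simp [hn]), ?_⟩, ?_⟩
    · simp only [inner_add_left, hnn]
    · rintro _ ⟨_, ⟨a, ha, b, hb, rfl⟩, rfl⟩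
      have hay : ⟪a, n⟫ ≤ ⟪y, n⟫ := hy ha
      have hbn : ⟪b, n⟫ ≤ ‖b‖ * ‖n‖ := real_inner_le_norm b n
      rw [mem_closedBall_zero_iff] at hb
      rw [hn, mul_one] at hbn
      simp only [inner_add_left]
      linarith
  rw [hsupp]
  refine ⟨y + (1 - t) • n, ?_, fun x hx hxc => ?_⟩
  · rw [inner_add_left, real_inner_smul_left, hnn]
    ring
  · refine ⟨y, hyL, x - y, ?_, add_sub_cancel y x⟩
    have horth : ⟪x - (y + (1 - t) • n), (1 - t) • n⟫ = 0 := by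
      rw [real_inner_smul_right, inner_sub_left, inner_add_left, real_inner_smul_left, hnn, hx]
      ring
    have hsplit : x - y = (x - (y + (1 - t) • n)) + (1 - t) • n := by abel
    have hpyth := norm_add_sq_real (x - (y + (1 - t) • n)) ((1 - t) • n)
    rw [← hsplit, horth, norm_smul, hn, mul_one, Real.norm_eq_abs, sq_abs] at hpyth
    have hsq : ‖x - (y + (1 - t) • n)‖ ^ 2 ≤ t :=
      (Real.le_sqrt (norm_nonneg _) ht0.le).mp hxc
    rw [mem_closedBall_zero_iff]
    exact (sq_le_one_iff₀ (norm_nonneg _)).mp (by nlinarith)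
end

section
/- Let U ⊆ ℝ^n and V ⊆ ℝ^d be open sets. Suppose ψ = (ψ₁, …, ψₙ) : V → U is a map each of whose component functions ψᵢ is DC on V, and f : U → ℝ is DC on U. Then the composition f ∘ ψ is DC on V. -/
/-- A function `f` on an open set `U ⊆ ℝ^d` is DC if every point of `U` has a convex open
neighborhood `V ⊆ U` on which `f` is the difference of two convex functions. -/
def IsDCOn {d : ℕ} (U : Set (EuclideanSpace ℝ (Fin d))) (f : EuclideanSpace ℝ (Fin d) → ℝ) :
    Prop :=
  ∀ x ∈ U, ∃ V : Set (EuclideanSpace ℝ (Fin d)), V ⊆ U ∧ IsOpen V ∧ Convex ℝ V ∧ x ∈ V ∧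
    ∃ g h : EuclideanSpace ℝ (Fin d) → ℝ, ConvexOn ℝ V g ∧ ConvexOn ℝ V h ∧
      ∀ y ∈ V, f y = g y - h y

open scoped Topology NNReal

theorem EuclideanSpace.norm_le_sum_abs {n : ℕ} (v : EuclideanSpace ℝ (Fin n)) :
    ‖v‖ ≤ ∑ i, |v i| := by
  refine abs_le_of_sq_le_sq' ?_ (Finset.sum_nonneg fun i _ => abs_nonneg (v i)) |>.2
  rw [EuclideanSpace.norm_sq_eq]
  exact Finset.sum_sq_le_sq_sum_of_nonneg fun i _ => norm_nonneg (v i)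

theorem IsDCOn.continuousAt {d : ℕ} {U : Set (EuclideanSpace ℝ (Fin d))}
    {f : EuclideanSpace ℝ (Fin d) → ℝ} (hf : IsDCOn U f) {x : EuclideanSpace ℝ (Fin d)}
    (hx : x ∈ U) : ContinuousAt f x := by
  obtain ⟨V, -, hVo, -, hxV, g, h, hg, hh, heq⟩ := hf x hx
  have hV : V ∈ 𝓝 x := hVo.mem_nhds hxV
  refine (((hg.continuousOn hVo).continuousAt hV).sub
    ((hh.continuousOn hVo).continuousAt hV)).congr ?_
  filter_upwards [hV] with y hy using (heq y hy).symm

/-- A Lipschitz convex function composed with a map whose components are differences of convex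
functions becomes convex after adding a large multiple of the sum of those convex functions. -/
theorem ConvexOn.comp_add_sum_of_lipschitzOnWith {n : ℕ} {E : Type*} [AddCommGroup E] [Module ℝ E]
    {B : Set E} {D : Set (EuclideanSpace ℝ (Fin n))} {ψ : E → EuclideanSpace ℝ (Fin n)}
    {a b : Fin n → E → ℝ} {g : EuclideanSpace ℝ (Fin n) → ℝ} {K : ℝ≥0}
    (hB : Convex ℝ B) (hψB : Set.MapsTo ψ B D)
    (ha : ∀ i, ConvexOn ℝ B (a i)) (hb : ∀ i, ConvexOn ℝ B (b i))
    (hab : ∀ i, ∀ x ∈ B, ψ x i = a i x - b i x)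
    (hg : ConvexOn ℝ D g) (hK : LipschitzOnWith K g D) :
    ConvexOn ℝ B (fun x => g (ψ x) + K * ∑ i, (a i x + b i x)) := by
  refine ⟨hB, fun x hx y hy s t hs ht hst => ?_⟩
  have hz := hB hx hy hs ht hst
  have hw := hg.1 (hψB hx) (hψB hy) hs ht hst
  have hconv := hg.2 (hψB hx) (hψB hy) hs ht hst
  set z := s • x + t • y
  set w := s • ψ x + t • ψ y
  have hlip : g (ψ z) - g w ≤ K * ‖ψ z - w‖ := by
    have := hK.dist_le_mul _ (hψB hz) _ hw
    rw [Real.dist_eq, dist_eq_norm] at this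
    exact (le_abs_self _).trans this
  have hnorm : ‖ψ z - w‖ ≤
      ∑ i, (s * (a i x + b i x) + t * (a i y + b i y) - (a i z + b i z)) := by
    refine (EuclideanSpace.norm_le_sum_abs _).trans (Finset.sum_le_sum fun i _ => ?_)
    have h1 := (ha i).2 hx hy hs ht hst
    have h2 := (hb i).2 hx hy hs ht hst
    simp only [smul_eq_mul] at h1 h2
    have h3 : (ψ z - w) i = (a i z - b i z) - (s * (a i x - b i x) + t * (a i y - b i y)) := by
      simp [w, hab i z hz, hab i x hx, hab i y hy]
    rw [h3, abs_le]
    constructor <;> linarith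
  have hmul := mul_le_mul_of_nonneg_left hnorm K.coe_nonneg
  rw [Finset.sum_sub_distrib, Finset.sum_add_distrib, ← Finset.mul_sum, ← Finset.mul_sum] at hmul
  simp only [smul_eq_mul] at hconv ⊢
  linarith

/-- Hartman's theorem: a DC function composed with a map with DC components is DC. -/
theorem statement16 {n d : ℕ} (U : Set (EuclideanSpace ℝ (Fin n)))
    (V : Set (EuclideanSpace ℝ (Fin d))) (hU : IsOpen U) (hV : IsOpen V)
    (ψ : EuclideanSpace ℝ (Fin d) → EuclideanSpace ℝ (Fin n)) (hmap : Set.MapsTo ψ V U)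
    (hψ : ∀ i : Fin n, IsDCOn V (fun x => ψ x i))
    (f : EuclideanSpace ℝ (Fin n) → ℝ) (hf : IsDCOn U f) :
    IsDCOn V (f ∘ ψ) := by
  intro x hx
  obtain ⟨W, -, hWo, -, hxW, g, h, hg, hh, hgh⟩ := hf (ψ x) (hmap hx)
  have hψc : ContinuousAt ψ x := by
    have : ContinuousAt (fun y i => ψ y i) x :=
      continuousAt_pi.2 fun i => (hψ i).continuousAt hx
    exact (PiLp.continuous_toLp 2 _).continuousAt.comp this
  choose A hAV hAo _ hxA a b ha hb hab using fun i => hψ i x hx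
  obtain ⟨K, s, hs, hKs⟩ := hg.locallyLipschitzOn hWo hxW
  obtain ⟨L, t, ht, hLt⟩ := hh.locallyLipschitzOn hWo hxW
  rw [hWo.nhdsWithin_eq hxW] at hs ht
  obtain ⟨r, hr, hrs⟩ := Metric.mem_nhds_iff.1
    (Filter.inter_mem (hWo.mem_nhds hxW) (Filter.inter_mem hs ht))
  obtain ⟨δ, hδ, hδs⟩ := Metric.mem_nhds_iff.1 (Filter.inter_mem (hV.mem_nhds hx)
    (Filter.inter_mem (Filter.iInter_mem.2 fun i => (hAo i).mem_nhds (hxA i))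
      (hψc.preimage_mem_nhds (Metric.ball_mem_nhds _ hr))))
  have hBA : ∀ i, Metric.ball x δ ⊆ A i := fun i y hy => Set.mem_iInter.1 (hδs hy).2.1 i
  have hψB : Set.MapsTo ψ (Metric.ball x δ) (Metric.ball (ψ x) r) := fun y hy => (hδs hy).2.2
  have hB : Convex ℝ (Metric.ball x δ) := convex_ball x δ
  have hD : Convex ℝ (Metric.ball (ψ x) r) := convex_ball _ r
  have ha' : ∀ i, ConvexOn ℝ (Metric.ball x δ) (a i) := fun i => (ha i).subset (hBA i) hB
  have hb' : ∀ i, ConvexOn ℝ (Metric.ball x δ) (b i) := fun i => (hb i).subset (hBA i) hB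
  have hab' : ∀ i, ∀ y ∈ Metric.ball x δ, ψ y i = a i y - b i y :=
    fun i y hy => hab i y (hBA i hy)
  have hgD := hg.subset (fun y hy => (hrs hy).1) hD
  have hhD := hh.subset (fun y hy => (hrs hy).1) hD
  refine ⟨Metric.ball x δ, fun y hy => (hδs hy).1, Metric.isOpen_ball, hB,
    Metric.mem_ball_self hδ,
    fun y => g (ψ y) + (max K L : ℝ≥0) * ∑ i, (a i y + b i y),
    fun y => h (ψ y) + (max K L : ℝ≥0) * ∑ i, (a i y + b i y),
    hgD.comp_add_sum_of_lipschitzOnWith hB hψB ha' hb' hab'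
      ((hKs.mono fun y hy => (hrs hy).2.1).weaken (le_max_left K L)),
    hhD.comp_add_sum_of_lipschitzOnWith hB hψB ha' hb' hab'
      ((hLt.mono fun y hy => (hrs hy).2.2).weaken (le_max_right K L)), fun y hy => ?_⟩
  rw [Function.comp_apply, hgh _ (hrs (hψB hy)).1]
  ring
end
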